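/- arXiv:1302.1368 — 2 statements merged into one kernel-verified Lean document; each statement's English description precedes it below -/
import Mathlib

section
/- Let 2<n<ω. There exist two atomic cylindric algebras of dimension n with the same atom structure, exactly one of which is representable: there is a countable CA_n atom structure S such that the term algebra Tm S is a representable CA_n while the complex algebra Cm S is not representable. Consequently RCA_n is not atom-canonical and not closed under completions, there is a non-representable CA_n with a dense representable subalgebra, and there is a countable atomic representable CA_n with no complete representation. -/
universe u v w

/-- An algebra of the similarity type of cylindric algebras, with dimensions
indexed by the type `ι`: a carrier with Boolean-type operations `add` (+),
`mul` (·), `neg` (−), constants `zero` (0), `one` (1), cylindrifications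
`c i` and diagonal constants `d i j` (no axioms are assumed). -/
structure RawCA (ι : Type v) : Type (max (u + 1) v) where
  carrier : Type u
  add : carrier → carrier → carrier
  mul : carrier → carrier → carrier
  neg : carrier → carrier
  zero : carrier
  one : carrier
  c : ι → carrier → carrier
  d : ι → ι → carrier

namespace RawCA

variable {ι : Type v}

/-- The Boolean order:  `x ≤ y` iff `x + y = y`. -/
def le (M : RawCA.{u, v} ι) (x y : M.carrier) : Prop := M.add x y = y

/-- `(A, +, ·, −, 0, 1)` is a Boolean algebra (Huntington's axioms). -/
def IsBoolean (M : RawCA.{u, v} ι) : Prop :=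
  (∀ x y, M.add x y = M.add y x) ∧
  (∀ x y, M.mul x y = M.mul y x) ∧
  (∀ x y z, M.add x (M.mul y z) = M.mul (M.add x y) (M.add x z)) ∧
  (∀ x y z, M.mul x (M.add y z) = M.add (M.mul x y) (M.mul x z)) ∧
  (∀ x, M.add x M.zero = x) ∧
  (∀ x, M.mul x M.one = x) ∧
  (∀ x, M.add x (M.neg x) = M.one) ∧
  (∀ x, M.mul x (M.neg x) = M.zero)

/-- `M` is a cylindric algebra of dimension `ι`: a Boolean algebra with the
cylindric axioms (C1)-(C7). -/
def IsCA (M : RawCA.{u, v} ι) : Prop :=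
  M.IsBoolean ∧
  (∀ i, M.c i M.zero = M.zero) ∧
  (∀ i x, M.le x (M.c i x)) ∧
  (∀ i x y, M.c i (M.mul x (M.c i y)) = M.mul (M.c i x) (M.c i y)) ∧
  (∀ i j x, M.c i (M.c j x) = M.c j (M.c i x)) ∧
  (∀ i, M.d i i = M.one) ∧
  (∀ i j k, i ≠ j → i ≠ k → M.d j k = M.c i (M.mul (M.d j i) (M.d i k))) ∧
  (∀ i j x, i ≠ j →
    M.mul (M.c i (M.mul (M.d i j) x)) (M.c i (M.mul (M.d i j) (M.neg x))) = M.zero)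

/-- Homomorphisms for the similarity type of cylindric algebras. -/
def IsHom (M : RawCA.{u, v} ι) (N : RawCA.{w, v} ι) (f : M.carrier → N.carrier) : Prop :=
  (∀ x y, f (M.add x y) = N.add (f x) (f y)) ∧
  (∀ x y, f (M.mul x y) = N.mul (f x) (f y)) ∧
  (∀ x, f (M.neg x) = N.neg (f x)) ∧
  f M.zero = N.zero ∧
  f M.one = N.one ∧
  (∀ i x, f (M.c i x) = N.c i (f x)) ∧
  (∀ i j, f (M.d i j) = N.d i j)

end RawCA

/-- The cylindrification operation on sets of `ι`-sequences. -/
def cylSet (ι U : Type*) (i : ι) (X : Set (ι → U)) : Set (ι → U) :=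
  {s | ∃ t ∈ X, ∀ j, j ≠ i → t j = s j}

/-- The diagonal elements:  sets of `ι`-sequences with equal `i`-th and `j`-th entries. -/
def diagSet (ι U : Type*) (i j : ι) : Set (ι → U) := {s | s i = s j}

/-- The full cylindric set algebra of dimension `ι` with base `U`. -/
def fullSetAlg (ι : Type v) (U : Type u) : RawCA.{max u v, v} ι where
  carrier := Set (ι → U)
  add X Y := X ∪ Y
  mul X Y := X ∩ Y
  neg X := Xᶜ
  zero := ∅
  one := Set.univ
  c := cylSet ι U
  d := diagSet ι U

/-- The direct product of a family of algebras of the cylindric similarity type. -/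
def prodAlg {ι : Type v} {I : Type w} (F : I → RawCA.{u, v} ι) : RawCA.{max u w, v} ι where
  carrier := ∀ i, (F i).carrier
  add f g := fun i => (F i).add (f i) (g i)
  mul f g := fun i => (F i).mul (f i) (g i)
  neg f := fun i => (F i).neg (f i)
  zero := fun i => (F i).zero
  one := fun i => (F i).one
  c j f := fun i => (F i).c j (f i)
  d j k := fun i => (F i).d j k

/-- `M` is a representable cylindric algebra of dimension `ι` (`M ∈ RCA_ι`):
`M` is isomorphic to a subalgebra of a direct product of full cylindric set
algebras of dimension `ι`. -/
def RawCA.Representable {ι : Type v} (M : RawCA.{u, v} ι) : Prop :=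
  ∃ (I : Type max u v) (U : I → Type max u v)
    (f : M.carrier → (prodAlg fun i => fullSetAlg ι (U i)).carrier),
    Function.Injective f ∧ RawCA.IsHom M (prodAlg fun i => fullSetAlg ι (U i)) f

/-- `f` neatly embeds `M` into the `ι`-neat reduct of `C` along the dimension
map `u : ι → κ`:  `f` is an injective homomorphism of `ι`-dimensional
cylindric algebras from `M` into the algebra `Nr C` of `u`-neat elements of
`C` (those fixed by every cylindrification whose index is outside the range
of `u`). -/
def IsNeatEmbedding {ι : Type*} {κ : Type*} (M : RawCA ι) (C : RawCA κ)
    (u : ι → κ) (f : M.carrier → C.carrier) : Prop :=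
  Function.Injective f ∧
  (∀ x y, f (M.add x y) = C.add (f x) (f y)) ∧
  (∀ x y, f (M.mul x y) = C.mul (f x) (f y)) ∧
  (∀ x, f (M.neg x) = C.neg (f x)) ∧
  f M.zero = C.zero ∧
  f M.one = C.one ∧
  (∀ i x, f (M.c i x) = C.c (u i) (f x)) ∧
  (∀ i j, f (M.d i j) = C.d (u i) (u j)) ∧
  (∀ x k, k ∉ Set.range u → C.c k (f x) = f x)

/-- `b` is an upper bound of `X` in `M`. -/
def RawCA.IsUB {ι : Type*} (M : RawCA ι) (X : Set M.carrier) (b : M.carrier) : Prop :=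
  ∀ x ∈ X, M.le x b

/-- `b` is the least upper bound (supremum) of `X` among those elements of
`M` that satisfy `P`. -/
def RawCA.IsLubWithin {ι : Type*} (M : RawCA ι) (P : M.carrier → Prop)
    (X : Set M.carrier) (b : M.carrier) : Prop :=
  P b ∧ M.IsUB X b ∧ ∀ b', P b' → M.IsUB X b' → M.le b b'

/-- `b` is the supremum of `X` in `M`. -/
def RawCA.IsLub {ι : Type*} (M : RawCA ι) (X : Set M.carrier) (b : M.carrier) : Prop :=
  M.IsLubWithin (fun _ => True) X b

/-- `b` is a lower bound of `X` in `M`. -/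
def RawCA.IsLB {ι : Type*} (M : RawCA ι) (X : Set M.carrier) (b : M.carrier) : Prop :=
  ∀ x ∈ X, M.le b x

/-- `b` is the infimum of `X` in `M`. -/
def RawCA.IsGlb {ι : Type*} (M : RawCA ι) (X : Set M.carrier) (b : M.carrier) : Prop :=
  M.IsLB X b ∧ ∀ b', M.IsLB X b' → M.le b' b

/-- `a` is an atom of `M`. -/
def RawCA.IsAtomOf {ι : Type*} (M : RawCA ι) (a : M.carrier) : Prop :=
  a ≠ M.zero ∧ ∀ y, M.le y a → y = M.zero ∨ y = a

/-- `M` is atomic: every nonzero element lies above an atom. -/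
def RawCA.Atomic {ι : Type*} (M : RawCA ι) : Prop :=
  ∀ x, x ≠ M.zero → ∃ a, M.IsAtomOf a ∧ M.le a x

/-- A complete representation of `M`:  an isomorphism of `M` onto a
subalgebra of a full cylindric set algebra of dimension `ι` carrying every
existing supremum to the corresponding union. -/
def RawCA.CompletelyRepresentable {ι : Type v} (M : RawCA.{u, v} ι) : Prop :=
  ∃ (U : Type max u v) (f : M.carrier → Set (ι → U)),
    Function.Injective f ∧ RawCA.IsHom M (fullSetAlg ι U) f ∧
    ∀ (X : Set M.carrier) (b : M.carrier), M.IsLub X b → f b = ⋃ x ∈ X, f x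

/-- An element of `C` is `u`-neat if it is fixed by every cylindrification
whose index lies outside the range of `u`  (the `u`-neat elements form the
neat reduct `Nr C`). -/
def RawCA.IsNeat {ι κ : Type*} (C : RawCA κ) (u : ι → κ) (b : C.carrier) : Prop :=
  ∀ k, k ∉ Set.range u → C.c k b = b

/-- `M ∈ S_c Nr_n CA_ω`:  `M` embeds (as a `CA_n`) into the neat `n`-reduct
of a cylindric algebra `C` of dimension ω in such a way that every subset of
`M` whose supremum in `M` is `1` also has supremum `1` in `Nr_n C`. -/
def memScNrOmega (n : ℕ) (M : RawCA.{u, 0} (Fin n)) : Prop :=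
  ∃ (C : RawCA.{u, 0} ℕ) (f : M.carrier → C.carrier),
    C.IsCA ∧ IsNeatEmbedding M C (fun i : Fin n => (i : ℕ)) f ∧
    ∀ X : Set M.carrier, M.IsLub X M.one →
      C.IsLubWithin (C.IsNeat (fun i : Fin n => (i : ℕ))) (f '' X) C.one

/-- The complex algebra `Cm S` of a `CA_n` atom structure
`S = (B, T_i, E_ij)`:  the Boolean algebra of all subsets of `B` with
`c_i X = {y : ∃ x ∈ X, x T_i y}` and `d_ij = E_ij`. -/
def cmAlg {n : ℕ} {B : Type} (T : Fin n → B → B → Prop) (E : Fin n → Fin n → Set B) :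
    RawCA.{0, 0} (Fin n) where
  carrier := Set B
  add X Y := X ∪ Y
  mul X Y := X ∩ Y
  neg X := Xᶜ
  zero := ∅
  one := Set.univ
  c i X := {y | ∃ x ∈ X, T i x y}
  d := E

/-- Membership in the subalgebra of `Cm S` generated by the singletons. -/
inductive InTm {n : ℕ} {B : Type} (T : Fin n → B → B → Prop) (E : Fin n → Fin n → Set B) :
    Set B → Prop
  | sing (b : B) : InTm T E {b}
  | empty : InTm T E ∅
  | univ : InTm T E Set.univ
  | union {X Y} : InTm T E X → InTm T E Y → InTm T E (X ∪ Y)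
  | inter {X Y} : InTm T E X → InTm T E Y → InTm T E (X ∩ Y)
  | compl {X} : InTm T E X → InTm T E Xᶜ
  | cyl (i : Fin n) {X} : InTm T E X → InTm T E {y | ∃ x ∈ X, T i x y}
  | diag (i j : Fin n) : InTm T E (E i j)

/-- The term algebra `Tm S` of a `CA_n` atom structure `S`:  the subalgebra
of `Cm S` generated by the singletons. -/
def tmAlg {n : ℕ} {B : Type} (T : Fin n → B → B → Prop) (E : Fin n → Fin n → Set B) :
    RawCA.{0, 0} (Fin n) where
  carrier := {X : Set B // InTm T E X}
  add X Y := ⟨X.1 ∪ Y.1, InTm.union X.2 Y.2⟩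
  mul X Y := ⟨X.1 ∩ Y.1, InTm.inter X.2 Y.2⟩
  neg X := ⟨X.1ᶜ, InTm.compl X.2⟩
  zero := ⟨∅, InTm.empty⟩
  one := ⟨Set.univ, InTm.univ⟩
  c i X := ⟨{y | ∃ x ∈ X.1, T i x y}, InTm.cyl i X.2⟩
  d i j := ⟨E i j, InTm.diag i j⟩

/-- The face of an `n`-tuple omitting position `p` consists of `n - 1` distinct points, when
equality of the entries of the tuple is given by `rel`. -/
def GoodFace {n : ℕ} (rel : Fin n → Fin n → Prop) (p : Fin n) : Prop :=
  ∀ j k, j ≠ p → k ≠ p → rel j k → j = k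

/-- Isomorphism types of `n`-tuples in an `(n - 1)`-uniform hypergraph with hyperedges labelled
by `L`, in which every set of `n` points has two faces with labels related by `ok`. -/
structure FaceType (n : ℕ) {L : Type} (ok : L → L → Prop) where
  rel : Fin n → Fin n → Prop
  eqv : Equivalence rel
  lab : Fin n → Option L
  lab_none : ∀ p, lab p = none ↔ ¬ GoodFace rel p
  lab_rel : ∀ p q, rel p q → lab p = lab q
  cons : (∀ p q, rel p q → p = q) → ∃ p q, p ≠ q ∧ ∃ a ∈ lab p, ∃ b ∈ lab q, ok a b

/-- Two face types agree except possibly at position `i`. -/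
def FaceType.Adj {n : ℕ} {L : Type} {ok : L → L → Prop} (i : Fin n) (M N : FaceType n ok) : Prop :=
  (∀ j k, j ≠ i → k ≠ i → (M.rel j k ↔ N.rel j k)) ∧ M.lab i = N.lab i

/-- The diagonal sets of face types. -/
def FaceType.diag {n : ℕ} {L : Type} (ok : L → L → Prop) (i j : Fin n) : Set (FaceType n ok) :=
  {M | M.rel i j}

theorem goodFace_of_rel {n : ℕ} {rel : Fin n → Fin n → Prop} (h : Equivalence rel) {p q : Fin n}
    (hpq : rel p q) (hp : GoodFace rel p) : GoodFace rel q := by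
  intro j k hj hk hjk
  by_cases hjp : j = p
  · by_cases hkp : k = p
    · rw [hjp, hkp]
    · by_cases hqp : q = p
      · exact absurd (hjp.trans hqp.symm) hj
      · subst hjp
        exact absurd (hp q k hqp hkp (h.trans (h.symm hpq) hjk)).symm hk
  · by_cases hkp : k = p
    · by_cases hqp : q = p
      · exact absurd (hkp.trans hqp.symm) hk
      · subst hkp
        exact absurd (hp q j hqp hjp (h.trans (h.symm hpq) (h.symm hjk))).symm hj
    · exact hp j k hjp hkp hjk

theorem goodFace_congr {n : ℕ} {rel : Fin n → Fin n → Prop} (h : Equivalence rel) {p q : Fin n}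
    (hpq : rel p q) : GoodFace rel p ↔ GoodFace rel q :=
  ⟨goodFace_of_rel h hpq, goodFace_of_rel h (h.symm hpq)⟩

theorem goodFace_congr_off {n : ℕ} {r r' : Fin n → Fin n → Prop} {p : Fin n}
    (h : ∀ j k, j ≠ p → k ≠ p → (r j k ↔ r' j k)) : GoodFace r p ↔ GoodFace r' p := by
  constructor <;> intro H j k hj hk hjk
  · exact H j k hj hk ((h j k hj hk).2 hjk)
  · exact H j k hj hk ((h j k hj hk).1 hjk)

namespace FaceType

variable {n : ℕ} {L : Type} {ok : L → L → Prop}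

theorem ext_of_le {M N : FaceType n ok} (h : M.rel = N.rel)
    (hl : ∀ p a, M.lab p = some a → N.lab p = some a) : M = N := by
  have hlab : M.lab = N.lab := by
    funext p
    cases hM : M.lab p with
    | none =>
      symm
      rw [N.lab_none, ← h, ← M.lab_none]
      exact hM
    | some a => exact (hl p a hM).symm
  cases M
  cases N
  simp only at h hlab
  subst h hlab
  rfl

theorem good_of_lab {M : FaceType n ok} {p : Fin n} {a : L} (h : M.lab p = some a) :
    GoodFace M.rel p := by
  by_contra hn
  rw [(M.lab_none p).2 hn] at h
  simp at h

theorem exists_lab {M : FaceType n ok} {p : Fin n} (h : GoodFace M.rel p) :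
    ∃ a, M.lab p = some a := by
  rw [← Option.ne_none_iff_exists']
  exact fun hp => (M.lab_none p).1 hp h

namespace Adj

variable {i : Fin n} {M N P : FaceType n ok}

theorem refl (M : FaceType n ok) : Adj i M M := ⟨fun _ _ _ _ => Iff.rfl, rfl⟩

theorem symm (h : Adj i M N) : Adj i N M :=
  ⟨fun j k hj hk => (h.1 j k hj hk).symm, h.2.symm⟩

theorem trans (h : Adj i M N) (h' : Adj i N P) : Adj i M P :=
  ⟨fun j k hj hk => (h.1 j k hj hk).trans (h'.1 j k hj hk), h.2.trans h'.2⟩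

/-- Agreement off `i` and a common identification of `i` with `j ≠ i` force equality. -/
theorem eq (h : Adj i M N) {j : Fin n} (hij : i ≠ j) (hM : M.rel i j) (hN : N.rel i j) :
    M = N := by
  have key : ∀ p q, M.rel p q ↔ N.rel p q := by
    have move : ∀ (P : FaceType n ok), P.rel i j → ∀ p q,
        P.rel p q ↔ P.rel (if p = i then j else p) (if q = i then j else q) := by
      intro P hP p q
      have aux : ∀ p, P.rel p (if p = i then j else p) := by
        intro p
        split_ifs with hp
        · rw [hp]; exact hP
        · exact P.eqv.refl p
      exact ⟨fun h => P.eqv.trans (P.eqv.symm (aux p)) (P.eqv.trans h (aux q)),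
        fun h => P.eqv.trans (aux p) (P.eqv.trans h (P.eqv.symm (aux q)))⟩
    intro p q
    rw [move M hM, move N hN]
    apply h.1 <;> split_ifs with hp
    all_goals first | exact hij.symm | exact hp
  refine ext_of_le (funext fun p => funext fun q => propext (key p q)) ?_
  intro p a hp
  have hg := good_of_lab hp
  by_cases hpi : p = i
  · rw [← hp, hpi, h.2]
  by_cases hpj : p = j
  · rw [← hp, hpj, ← M.lab_rel i j hM, ← N.lab_rel i j hN, h.2]
  · exact absurd (hg i j (Ne.symm hpi) (Ne.symm hpj) hM) hij

end Adj

/-- Labels on two prescribed faces extend to a face type. -/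
theorem exists_extend [Nonempty L] (hn : 2 < n) (hok : ∀ a, ∃ b, ok a b)
    {rel : Fin n → Fin n → Prop} (h : Equivalence rel) {i j : Fin n} {x y : Option L}
    (hx : x = none ↔ ¬ GoodFace rel i) (hy : y = none ↔ ¬ GoodFace rel j)
    (hxy : rel i j → x = y) :
    ∃ M : FaceType n ok, M.rel = rel ∧ M.lab i = x ∧ M.lab j = y := by
  classical
  obtain ⟨z, hz⟩ : ∃ z : L, ∀ a, x = some a → ok a z := by
    cases x with
    | none => exact ⟨Classical.arbitrary L, by simp⟩
    | some a =>
      obtain ⟨b, hb⟩ := hok a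
      exact ⟨b, fun a' ha' => by cases ha'; exact hb⟩
  have hlab : ∀ p, (if rel p i then x else if rel p j then y else
      if GoodFace rel p then some z else none) = none ↔ ¬ GoodFace rel p := by
    intro p
    split_ifs with h1 h2 h3
    · rw [hx, goodFace_congr h h1]
    · rw [hy, goodFace_congr h h2]
    · simp [h3]
    · simp [h3]
  refine ⟨⟨rel, h, fun p => if rel p i then x else if rel p j then y else
      if GoodFace rel p then some z else none, hlab, ?_, ?_⟩, rfl, ?_, ?_⟩
  · intro p q hpq
    have e1 : ∀ r, rel p r ↔ rel q r := fun r =>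
      ⟨fun hr => h.trans (h.symm hpq) hr, fun hr => h.trans hpq hr⟩
    simp only [e1, goodFace_congr h hpq]
  · intro ht
    obtain ⟨k, hki, hkj⟩ := Fin.exists_ne_and_ne_of_two_lt i j hn
    have hg : ∀ p, GoodFace rel p := fun p q r _ _ hqr => ht q r hqr
    obtain ⟨a, ha⟩ : ∃ a, x = some a :=
      Option.ne_none_iff_exists'.1 fun hx' => hx.1 hx' (hg i)
    refine ⟨i, k, hki.symm, a, ?_, z, ?_, hz a ha⟩
    · simp [h.refl i, ha]
    · have h1 : ¬ rel k i := fun hk => hki (ht k i hk)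
      have h2 : ¬ rel k j := fun hk => hkj (ht k j hk)
      simp [h1, h2, hg k]
  · simp [h.refl i]
  · by_cases hji : rel j i
    · simp [hji, hxy (h.symm hji)]
    · simp [hji, h.refl j]

/-- Every face type can be altered at position `i` so as to identify `i` with `j`. -/
theorem exists_adj_rel [Nonempty L] (hn : 2 < n) (hok : ∀ a, ∃ b, ok a b) (M : FaceType n ok)
    {i j : Fin n} (hij : i ≠ j) : ∃ N, Adj i N M ∧ N.rel i j := by
  classical
  let τ : Fin n → Fin n := fun p => if p = i then j else p
  have hτi : τ i = j := if_pos rfl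
  have hτ : ∀ p, p ≠ i → τ p = p := fun p hp => if_neg hp
  have heqv : Equivalence fun p q => M.rel (τ p) (τ q) :=
    ⟨fun _ => M.eqv.refl _, fun h => M.eqv.symm h, fun h h' => M.eqv.trans h h'⟩
  have hoff : ∀ p q, p ≠ i → q ≠ i → (M.rel (τ p) (τ q) ↔ M.rel p q) := by
    intro p q hp hq
    rw [hτ p hp, hτ q hq]
  have hrel : M.rel (τ i) (τ j) := by
    rw [hτi, hτ j hij.symm]
    exact M.eqv.refl j
  have hgi : M.lab i = none ↔ ¬ GoodFace (fun p q => M.rel (τ p) (τ q)) i := by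
    rw [goodFace_congr_off hoff, M.lab_none]
  obtain ⟨N, hN, hNi, -⟩ := exists_extend (ok := ok) hn hok heqv hgi
    (by rw [hgi, goodFace_congr heqv hrel]) (fun _ => rfl)
  refine ⟨N, ⟨fun p q hp hq => ?_, hNi⟩, ?_⟩
  · rw [hN]; exact hoff p q hp hq
  · rw [hN]; exact hrel

/-- The relations `Adj i` and `Adj j` commute. -/
theorem adj_comm [Nonempty L] (hn : 2 < n) (hok : ∀ a, ∃ b, ok a b) {i j : Fin n}
    {M P N : FaceType n ok} (h : Adj i M P) (h' : Adj j P N) : ∃ Q, Adj j M Q ∧ Adj i Q N := by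
  classical
  by_cases hij : i = j
  · subst hij
    exact ⟨P, h, h'⟩
  have hMN : ∀ p q, p ≠ i → q ≠ i → p ≠ j → q ≠ j → (M.rel p q ↔ N.rel p q) :=
    fun p q hp hq hp' hq' => (h.1 p q hp hq).trans (h'.1 p q hp' hq')
  let near : Fin n → Fin n → Prop := fun p w =>
    (p = i ∧ M.rel p w) ∨ (p = j ∧ N.rel p w) ∨ (p ≠ i ∧ p ≠ j ∧ M.rel p w)
  let rel : Fin n → Fin n → Prop := fun p q =>
    p = q ∨ ∃ w, w ≠ i ∧ w ≠ j ∧ near p w ∧ near q w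
  have hM : ∀ p w, p ≠ j → w ≠ i → w ≠ j → (near p w ↔ M.rel p w) := by
    intro p w hp _ _
    by_cases hpi : p = i <;> simp [near, hpi, hp, hij]
  have hN : ∀ p w, p ≠ i → w ≠ i → w ≠ j → (near p w ↔ N.rel p w) := by
    intro p w hp hw hw'
    by_cases hpj : p = j
    · simp [near, hpj, Ne.symm hij]
    · simp [near, hp, hpj, hMN p w hp hw hpj hw']
  have hnn : ∀ p w w', w ≠ i → w ≠ j → w' ≠ i → w' ≠ j → near p w → (near p w' ↔ M.rel w w') := by
    intro p w w' hw hw' hv hv' hp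
    by_cases hpj : p = j
    · have hpi : p ≠ i := fun hh => hij (hh.symm.trans hpj)
      rw [hN p w hpi hw hw'] at hp
      rw [hN p w' hpi hv hv', hMN w w' hw hv hw' hv']
      exact ⟨fun hh => N.eqv.trans (N.eqv.symm hp) hh, fun hh => N.eqv.trans hp hh⟩
    · rw [hM p w hpj hw hw'] at hp
      rw [hM p w' hpj hv hv']
      exact ⟨fun hh => M.eqv.trans (M.eqv.symm hp) hh, fun hh => M.eqv.trans hp hh⟩
  have heqv : Equivalence rel := by
    refine ⟨fun p => Or.inl rfl, ?_, ?_⟩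
    · rintro p q (rfl | ⟨w, h1, h2, h3, h4⟩)
      · exact Or.inl rfl
      · exact Or.inr ⟨w, h1, h2, h4, h3⟩
    · rintro p q r (rfl | ⟨w, h1, h2, h3, h4⟩) (rfl | ⟨w', h1', h2', h3', h4'⟩)
      · exact Or.inl rfl
      · exact Or.inr ⟨w', h1', h2', h3', h4'⟩
      · exact Or.inr ⟨w, h1, h2, h3, h4⟩
      · have := (hnn q w w' h1 h2 h1' h2' h4).1 h3'
        exact Or.inr ⟨w', h1', h2', (hnn p w w' h1 h2 h1' h2' h3).2 this, h4'⟩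
  have hself : ∀ w, w ≠ i → w ≠ j → near w w :=
    fun w hw hw' => (hM w w hw' hw hw').2 (M.eqv.refl w)
  have relM : ∀ p q, p ≠ j → q ≠ j → (rel p q ↔ M.rel p q) := by
    intro p q hp hq
    constructor
    · rintro (rfl | ⟨w, h1, h2, h3, h4⟩)
      · exact M.eqv.refl _
      · exact M.eqv.trans ((hM p w hp h1 h2).1 h3) (M.eqv.symm ((hM q w hq h1 h2).1 h4))
    · intro hpq
      by_cases hpi : p = i
      · by_cases hqi : q = i
        · exact Or.inl (hpi.trans hqi.symm)
        · exact Or.inr ⟨q, hqi, hq, (hM p q hp hqi hq).2 hpq, hself q hqi hq⟩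
      · exact Or.inr ⟨p, hpi, hp, hself p hpi hp, (hM q p hq hpi hp).2 (M.eqv.symm hpq)⟩
  have relN : ∀ p q, p ≠ i → q ≠ i → (rel p q ↔ N.rel p q) := by
    intro p q hp hq
    constructor
    · rintro (rfl | ⟨w, h1, h2, h3, h4⟩)
      · exact N.eqv.refl _
      · exact N.eqv.trans ((hN p w hp h1 h2).1 h3) (N.eqv.symm ((hN q w hq h1 h2).1 h4))
    · intro hpq
      by_cases hpj : p = j
      · by_cases hqj : q = j
        · exact Or.inl (hpj.trans hqj.symm)
        · exact Or.inr ⟨q, hq, hqj, (hN p q hp hq hqj).2 hpq, hself q hq hqj⟩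
      · exact Or.inr ⟨p, hp, hpj, hself p hp hpj, (hN q p hq hp hpj).2 (N.eqv.symm hpq)⟩
  have hgi : N.lab i = none ↔ ¬ GoodFace rel i := by rw [goodFace_congr_off relN, N.lab_none]
  have hgj : M.lab j = none ↔ ¬ GoodFace rel j := by rw [goodFace_congr_off relM, M.lab_none]
  obtain ⟨Q, hQ, hQi, hQj⟩ := exists_extend (ok := ok) hn hok heqv hgi hgj (by
    intro hr
    have hbad : ¬ GoodFace rel i := by
      obtain (hh | ⟨w, h1, h2, h3, h4⟩) := hr
      · exact absurd hh hij
      · intro hg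
        exact h2 (hg j w (Ne.symm hij) h1 (Or.inr ⟨w, h1, h2, h4, hself w h1 h2⟩)).symm
    rw [hgi.2 hbad, hgj.2 ((goodFace_congr heqv hr).not.1 hbad)])
  refine ⟨Q, ⟨fun p q hp hq => ?_, hQj.symm⟩, ⟨fun p q hp hq => ?_, hQi⟩⟩
  · rw [hQ]; exact (relM p q hp hq).symm
  · rw [hQ]; exact relN p q hp hq

theorem isCA [Nonempty L] (hn : 2 < n) (hok : ∀ a, ∃ b, ok a b) :
    (cmAlg (Adj (n := n) (ok := ok)) (diag ok)).IsCA := by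
  refine ⟨⟨fun _ _ => Set.union_comm _ _, fun _ _ => Set.inter_comm _ _,
    fun _ _ _ => Set.union_inter_distrib_left _ _ _,
    fun _ _ _ => Set.inter_union_distrib_left _ _ _, fun _ => Set.union_empty _,
    fun _ => Set.inter_univ _, fun _ => Set.union_compl_self _,
    fun _ => Set.inter_compl_self _⟩, ?_, ?_, ?_, ?_, ?_, ?_, ?_⟩
  · intro i
    refine Set.ext fun M => ?_
    simp [cmAlg]
  · intro i X
    exact Set.union_eq_right.2 fun M hM => ⟨M, hM, Adj.refl M⟩
  · intro i X Y
    refine Set.ext fun M => ?_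
    constructor
    · rintro ⟨N, ⟨hN, P, hP, hPN⟩, hNM⟩
      exact ⟨⟨N, hN, hNM⟩, P, hP, hPN.trans hNM⟩
    · rintro ⟨⟨N, hN, hNM⟩, P, hP, hPM⟩
      exact ⟨N, ⟨hN, P, hP, hPM.trans hNM.symm⟩, hNM⟩
  · intro i j X
    refine Set.ext fun M => ?_
    constructor
    · rintro ⟨N, ⟨P, hP, hPN⟩, hNM⟩
      obtain ⟨Q, h1, h2⟩ := adj_comm hn hok hPN hNM
      exact ⟨Q, ⟨P, hP, h1⟩, h2⟩
    · rintro ⟨N, ⟨P, hP, hPN⟩, hNM⟩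
      obtain ⟨Q, h1, h2⟩ := adj_comm hn hok hPN hNM
      exact ⟨Q, ⟨P, hP, h1⟩, h2⟩
  · intro i
    exact Set.eq_univ_of_forall fun M => M.eqv.refl i
  · intro i j k hij hik
    refine Set.ext fun M => ?_
    constructor
    · intro hM
      obtain ⟨N, hNM, hN⟩ := exists_adj_rel hn hok M hij
      exact ⟨N, ⟨N.eqv.symm hN, N.eqv.trans hN ((hNM.1 j k hij.symm hik.symm).2 hM)⟩, hNM⟩
    · rintro ⟨N, ⟨h1, h2⟩, hNM⟩
      exact (hNM.1 j k hij.symm hik.symm).1 (N.eqv.trans h1 h2)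
  · intro i j X hij
    refine Set.eq_empty_of_forall_notMem ?_
    rintro M ⟨⟨N, ⟨hN, hNX⟩, hNM⟩, P, ⟨hP, hPX⟩, hPM⟩
    exact hPX ((Adj.eq (hNM.trans hPM.symm) hij hN hP) ▸ hNX)

end FaceType
/-- Ramsey's theorem for colourings of the `k`-element sets of natural numbers. -/
theorem exists_homogeneous {C : Type} [Finite C] (k : ℕ) (χ : Finset ℕ → C) (N : ℕ) :
    ∃ (c : C) (H : Finset ℕ), H.card = N ∧ ∀ S ⊆ H, S.card = k → χ S = c := by
  classical
  have hlim : ∀ φ : ℕ → C, ∃ c, ∀ᶠ v in (Filter.hyperfilter ℕ : Filter ℕ), φ v = c := by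
    intro φ
    rw [← Ultrafilter.eventually_exists_iff]
    exact Filter.Eventually.of_forall fun v => ⟨φ v, rfl⟩
  choose lim hlim using hlim
  let F : ℕ → Finset ℕ → C := fun j => Nat.rec χ (fun _ G S => lim fun v => G (insert v S)) j
  have hF : ∀ j S, ∀ᶠ v in (Filter.hyperfilter ℕ : Filter ℕ), F j (insert v S) = F (j + 1) S :=
    fun j S => hlim fun v => F j (insert v S)
  have main : ∃ H : Finset ℕ, H.card = N ∧ ∀ S ⊆ H, S.card ≤ k → F (k - S.card) S = F k ∅ := by
    induction N with
    | zero =>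
      refine ⟨∅, rfl, fun S hS _ => ?_⟩
      rw [Finset.subset_empty.1 hS]
      rfl
    | succ N ih =>
      obtain ⟨H, hcard, hH⟩ := ih
      have h1 : ∀ᶠ v in (Filter.hyperfilter ℕ : Filter ℕ), v ∉ H :=
        Filter.hyperfilter_le_cofinite H.finite_toSet.compl_mem_cofinite
      have h2 : ∀ᶠ v in (Filter.hyperfilter ℕ : Filter ℕ), ∀ S ∈ H.powerset, S.card < k →
          F (k - (S.card + 1)) (insert v S) = F k ∅ := by
        rw [Filter.eventually_all_finset]
        intro S hS
        by_cases hk : S.card < k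
        · filter_upwards [hF (k - (S.card + 1)) S] with v hv _
          rw [hv, ← hH S (Finset.mem_powerset.1 hS) hk.le,
            show k - S.card = k - (S.card + 1) + 1 by omega]
        · exact Filter.Eventually.of_forall fun v h => absurd h hk
      obtain ⟨v, hv, hv'⟩ := (h1.and h2).exists
      refine ⟨insert v H, by rw [Finset.card_insert_of_notMem hv, hcard], fun S hS hk => ?_⟩
      by_cases hvS : v ∈ S
      · have hsub : S.erase v ⊆ H := by
          rw [← Finset.subset_insert_iff]
          exact hS
        have hc := Finset.card_erase_add_one hvS
        have := hv' (S.erase v) (Finset.mem_powerset.2 hsub) (by omega)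
        rwa [hc, Finset.insert_erase hvS] at this
      · exact hH S ((Finset.subset_insert_iff_of_notMem hvS).1 hS) hk
  obtain ⟨H, hcard, hH⟩ := main
  refine ⟨F k ∅, H, hcard, fun S hS hk => ?_⟩
  have := hH S hS hk.le
  rwa [hk, Nat.sub_self] at this

theorem map_biUnion_of_map_union {α β J : Type*} {g : Set α → Set β} (h0 : g ∅ = ∅)
    (hu : ∀ X Y, g (X ∪ Y) = g X ∪ g Y) (s : Finset J) (A : J → Set α) :
    g (⋃ j ∈ s, A j) = ⋃ j ∈ s, g (A j) := by
  classical
  induction s using Finset.induction_on with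
  | empty => simpa using h0
  | insert a s ha ih => rw [Finset.set_biUnion_insert, Finset.set_biUnion_insert, hu, ih]

theorem insertNth_castSucc_eq_succ {m : ℕ} {α : Type*} (w : Fin m → α) (i : Fin m) :
    i.castSucc.insertNth (α := fun _ => α) (w i) w = i.succ.insertNth (α := fun _ => α) (w i) w := by
  rw [Fin.insertNth_eq_iff]
  refine ⟨?_, funext fun k => ?_⟩
  · have h : i.castSucc = i.succ.succAbove i := by simp
    rw [h, Fin.insertNth_apply_succAbove]
  · rw [Fin.removeNth_apply]
    by_cases hk : k = i
    · subst hk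
      rw [Fin.succAbove_castSucc_self, Fin.insertNth_apply_same]
    · have h : i.castSucc.succAbove k = i.succ.succAbove k := by
        have : (k : ℕ) ≠ i := fun h => hk (Fin.ext h)
        ext
        simp only [Fin.succAbove, Fin.lt_def, Fin.val_castSucc, Fin.val_succ]
        split_ifs <;> first | rfl | omega
      rw [h, Fin.insertNth_apply_succAbove]

namespace FaceType

/-- The face type in which only two positions `i₁` and `i₂` are identified; it has exactly one
label `a`. -/
def ofLabel {n : ℕ} {L : Type} (ok : L → L → Prop) {i₁ i₂ : Fin n} (h : i₁ ≠ i₂) (a : L) :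
    FaceType n ok where
  rel p q := p = q ∨ ((p = i₁ ∨ p = i₂) ∧ (q = i₁ ∨ q = i₂))
  eqv := by
    refine ⟨fun _ => Or.inl rfl, ?_, ?_⟩
    · rintro p q (h | ⟨h, h'⟩)
      · exact Or.inl h.symm
      · exact Or.inr ⟨h', h⟩
    · rintro p q r (rfl | ⟨h, h'⟩) (rfl | ⟨h1, h1'⟩)
      · exact Or.inl rfl
      · exact Or.inr ⟨h1, h1'⟩
      · exact Or.inr ⟨h, h'⟩
      · exact Or.inr ⟨h, h1'⟩
  lab p := if p = i₁ ∨ p = i₂ then some a else none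
  lab_none p := by
    split_ifs with hp
    · simp only [false_iff, not_not]
      intro j k hj hk hjk
      grind
    · simp only [true_iff]
      intro hg
      exact h (hg i₁ i₂ (fun h => hp (Or.inl h.symm)) (fun h => hp (Or.inr h.symm))
        (Or.inr ⟨Or.inl rfl, Or.inr rfl⟩))
  lab_rel p q := by
    rintro (rfl | ⟨h, h'⟩)
    · rfl
    · simp [h, h']
  cons ht := absurd (ht i₁ i₂ (Or.inr ⟨Or.inl rfl, Or.inr rfl⟩)) h

/-- The face type in which exactly the three positions `i₀`, `i₁` and `i₂` are identified. -/
def triple {n : ℕ} {L : Type} (ok : L → L → Prop) {i₀ i₁ i₂ : Fin n} (h : i₁ ≠ i₂) (h1 : i₀ ≠ i₁)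
    (h2 : i₀ ≠ i₂) : FaceType n ok where
  rel p q := p = q ∨ ((p = i₀ ∨ p = i₁ ∨ p = i₂) ∧ (q = i₀ ∨ q = i₁ ∨ q = i₂))
  eqv := by
    refine ⟨fun _ => Or.inl rfl, ?_, ?_⟩
    · rintro p q (h | ⟨h, h'⟩)
      · exact Or.inl h.symm
      · exact Or.inr ⟨h', h⟩
    · rintro p q r (rfl | ⟨h, h'⟩) (rfl | ⟨h1, h1'⟩)
      · exact Or.inl rfl
      · exact Or.inr ⟨h1, h1'⟩
      · exact Or.inr ⟨h, h'⟩
      · exact Or.inr ⟨h, h1'⟩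
  lab _ := none
  lab_none p := by
    simp only [true_iff]
    intro hg
    have a := hg i₀ i₁
    have b := hg i₀ i₂
    have c := hg i₁ i₂
    grind
  lab_rel _ _ _ := rfl
  cons ht := absurd (ht i₁ i₂ (Or.inr ⟨Or.inr (Or.inl rfl), Or.inr (Or.inr rfl)⟩)) h

theorem adj_ofLabel_triple {n : ℕ} {L : Type} (ok : L → L → Prop) {i₀ i₁ i₂ : Fin n}
    (h : i₁ ≠ i₂) (h1 : i₀ ≠ i₁) (h2 : i₀ ≠ i₂) (a : L) :
    Adj i₀ (ofLabel ok h a) (triple ok h h1 h2) := by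
  refine ⟨fun j k hj hk => ?_, ?_⟩
  · simp [ofLabel, triple, hj, hk]
  · simp [ofLabel, triple, h1, h2]

/-- If finitely many classes of labels refine the complement of `ok`, then the complex algebra is
not representable. -/
theorem not_representable {m : ℕ} (hm : 2 ≤ m) {L C : Type} [Infinite L] [Finite C]
    {ok : L → L → Prop} (κ : L → C) (hκ : ∀ a b, ok a b → κ a ≠ κ b) :
    ¬ (cmAlg (Adj (n := m + 1) (ok := ok)) (diag ok)).Representable := by
  classical
  rintro ⟨I, U, f, hinj, hadd, hmul, -, hzero, -, hc, hd⟩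
  let i₀ : Fin (m + 1) := ⟨0, by omega⟩
  let i₁ : Fin (m + 1) := ⟨1, by omega⟩
  let i₂ : Fin (m + 1) := ⟨2, by omega⟩
  have h12 : i₁ ≠ i₂ := by simp [i₁, i₂]
  have h01 : i₀ ≠ i₁ := by simp [i₀, i₁]
  have h02 : i₀ ≠ i₂ := by simp [i₀, i₂]
  obtain ⟨P, hP⟩ : ∃ P, ∀ a, Adj i₀ (ofLabel ok h12 a) P :=
    ⟨_, adj_ofLabel_triple ok h12 h01 h02⟩
  obtain ⟨ι, hι⟩ : ∃ ι, f ({P} : Set _) ι ≠ (∅ : Set (Fin (m + 1) → U ι)) := by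
    by_contra! hcon
    have : f ({P} : Set _) = f (∅ : Set _) := by
      rw [show f (∅ : Set _) = _ from hzero]
      exact funext hcon
    exact Set.singleton_ne_empty P (hinj this)
  obtain ⟨g, hg⟩ : ∃ g : Set (FaceType (m + 1) ok) → Set (Fin (m + 1) → U ι), ∀ X, g X = f X ι :=
    ⟨fun X => f X ι, fun _ => rfl⟩
  rw [← hg] at hι
  have g0 : g ∅ = ∅ := (hg _).trans (congrFun hzero ι)
  have gu : ∀ X Y, g (X ∪ Y) = g X ∪ g Y := fun X Y => by
    simp only [hg]; exact congrFun (hadd X Y) ι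
  have gi : ∀ X Y, g (X ∩ Y) = g X ∩ g Y := fun X Y => by
    simp only [hg]; exact congrFun (hmul X Y) ι
  have gc : ∀ i X, g {y | ∃ x ∈ X, Adj i x y} = cylSet _ _ i (g X) := fun i X => by
    simp only [hg]; exact congrFun (hc i X) ι
  have gd : ∀ i j, g (diag ok i j) = diagSet _ _ i j := fun i j => by
    simp only [hg]; exact congrFun (hd i j) ι
  have gmono : ∀ X Y, X ⊆ Y → g X ⊆ g Y := fun X Y h => by
    rw [← Set.union_eq_right.2 h, gu]; exact Set.subset_union_left
  -- the base is infinite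
  obtain ⟨s, hs⟩ := Set.nonempty_iff_ne_empty.2 hι
  have ht : ∀ a, ∃ t ∈ g {ofLabel ok h12 a}, ∀ j, j ≠ i₀ → t j = s j := by
    intro a
    have : s ∈ g {y | ∃ x ∈ ({ofLabel ok h12 a} : Set _), Adj i₀ x y} :=
      gmono {P} _ (by rintro _ rfl; exact ⟨_, rfl, hP a⟩) hs
    rwa [gc] at this
  choose t htg hts using ht
  have hlabinj : ∀ a b, ofLabel ok h12 a = ofLabel ok h12 b → a = b := by
    intro a b hab
    have := congrArg (fun M => FaceType.lab M i₁) hab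
    simpa [ofLabel] using this
  have htinj : Function.Injective fun a => t a i₀ := by
    intro a b hab
    have heq : t a = t b := by
      funext j
      by_cases hj : j = i₀
      · rw [hj]; exact hab
      · rw [hts a j hj, hts b j hj]
    by_contra hne
    have h1 : t a ∈ g ({ofLabel ok h12 a} ∩ {ofLabel ok h12 b}) := by
      rw [gi]; exact ⟨htg a, heq ▸ htg b⟩
    have h2 : ({ofLabel ok h12 a} ∩ {ofLabel ok h12 b} : Set (FaceType (m + 1) ok)) = ∅ := by
      refine Set.eq_empty_of_forall_notMem ?_
      rintro M ⟨rfl, h⟩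
      exact hne (hlabinj _ _ h)
    rw [h2, g0] at h1
    exact h1
  have : Infinite (U ι) := Infinite.of_injective _ htinj
  let pts := Infinite.natEmbedding (U ι)
  -- colours of faces
  let G : Fin (m + 1) → C → Set (FaceType (m + 1) ok) :=
    fun p c => {M | ∃ a, M.lab p = some a ∧ κ a = c}
  have hGc : ∀ p c, {y | ∃ x ∈ G p c, Adj p x y} = G p c := by
    intro p c
    ext M
    constructor
    · rintro ⟨N, ⟨a, ha, hac⟩, hNM⟩
      exact ⟨a, hNM.2 ▸ ha, hac⟩
    · exact fun hM => ⟨M, hM, Adj.refl M⟩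
  have hGchange : ∀ p c x y (w : Fin m → U ι),
      p.insertNth (α := fun _ => U ι) x w ∈ g (G p c) →
      p.insertNth (α := fun _ => U ι) y w ∈ g (G p c) := by
    intro p c x y w h
    rw [← hGc, gc]
    refine ⟨_, h, fun j hj => ?_⟩
    obtain ⟨k, rfl⟩ := Fin.exists_succAbove_eq hj
    simp
  have hGmove : ∀ p q c (v : Fin (m + 1) → U ι), v p = v q → v ∈ g (G p c) → v ∈ g (G q c) := by
    intro p q c v hpq hv
    have h1 : v ∈ g (G p c ∩ diag ok p q) := by
      rw [gi, gd]; exact ⟨hv, hpq⟩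
    refine gmono _ _ ?_ h1
    rintro M ⟨⟨a, ha, hac⟩, hM⟩
    exact ⟨a, M.lab_rel p q hM ▸ ha, hac⟩
  have hGexists : ∀ p (v : Fin (m + 1) → U ι),
      (∀ j k, j ≠ p → k ≠ p → v j = v k → j = k) → ∃ c, v ∈ g (G p c) := by
    intro p v hv
    have := Fintype.ofFinite C
    by_contra! hno
    let D : Finset (Fin (m + 1) × Fin (m + 1)) :=
      {jk | jk.1 ≠ p ∧ jk.2 ≠ p ∧ jk.1 ≠ jk.2}
    have huniv : (Set.univ : Set (FaceType (m + 1) ok)) =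
        (⋃ jk ∈ D, diag ok jk.1 jk.2) ∪ ⋃ c ∈ (Finset.univ : Finset C), G p c := by
      symm
      refine Set.eq_univ_of_forall fun M => ?_
      by_cases hM : GoodFace M.rel p
      · right
        obtain ⟨a, ha⟩ := exists_lab hM
        simp only [Finset.mem_univ, Set.iUnion_true, Set.mem_iUnion]
        exact ⟨κ a, a, ha, rfl⟩
      · left
        simp only [GoodFace, not_forall] at hM
        obtain ⟨j, k, hj, hk, hjk, hne⟩ := hM
        simp only [Set.mem_iUnion]
        exact ⟨(j, k), by simp [D, hj, hk, hne], hjk⟩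
    have hvuniv : v ∈ g Set.univ := by
      rw [show (Set.univ : Set (FaceType (m + 1) ok)) = diag ok p p from
        (Set.eq_univ_of_forall fun M => M.eqv.refl p).symm, gd]
      exact (rfl : v p = v p)
    rw [huniv, gu, map_biUnion_of_map_union g0 gu, map_biUnion_of_map_union g0 gu] at hvuniv
    simp only [Set.mem_union, Set.mem_iUnion, gd] at hvuniv
    obtain ⟨jk, hjk, h⟩ | ⟨c, -, h⟩ := hvuniv
    · simp only [D, Finset.mem_filter, Finset.mem_univ, true_and] at hjk
      exact hjk.2.2 (hv _ _ hjk.1 hjk.2.1 h)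
    · exact hno c h
  have hcol : ∀ S : Finset ℕ, ∃ c, ∀ hS : S.card = m, ∀ p x,
      p.insertNth (α := fun _ => U ι) x (fun j => pts (S.orderEmbOfFin hS j)) ∈ g (G p c) := by
    intro S
    by_cases hS : S.card = m
    swap
    · exact ⟨κ (Classical.arbitrary L), fun h => absurd h hS⟩
    obtain ⟨c, hc⟩ := hGexists 0
      ((0 : Fin (m + 1)).insertNth (α := fun _ => U ι) (s 0)
        (fun j => pts (S.orderEmbOfFin hS j))) (by
        intro j k hj hk hjk
        obtain ⟨j, rfl⟩ := Fin.exists_succAbove_eq hj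
        obtain ⟨k, rfl⟩ := Fin.exists_succAbove_eq hk
        simp only [Fin.insertNth_apply_succAbove] at hjk
        rw [(S.orderEmbOfFin hS).injective (pts.injective hjk)])
    refine ⟨c, fun _ p => ?_⟩
    induction p using Fin.induction with
    | zero => exact fun x => hGchange _ _ _ x _ hc
    | succ i ih =>
      intro x
      have h1 := ih (pts (S.orderEmbOfFin hS i))
      have heq : i.castSucc.insertNth (α := fun _ => U ι) (pts (S.orderEmbOfFin hS i))
          (fun j => pts (S.orderEmbOfFin hS j)) =
          i.succ.insertNth (α := fun _ => U ι) (pts (S.orderEmbOfFin hS i))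
          (fun j => pts (S.orderEmbOfFin hS j)) := 
          insertNth_castSucc_eq_succ (fun j => pts (S.orderEmbOfFin hS j)) i
      have h2 := hGmove i.castSucc i.succ c _ (by
        rw [Fin.insertNth_apply_same, heq, Fin.insertNth_apply_same]) h1
      rw [heq] at h2
      exact hGchange _ _ _ x _ h2
  choose χ hχ using hcol
  obtain ⟨c, H, hH, hHc⟩ := exists_homogeneous m χ (m + 1)
  let v : Fin (m + 1) → ℕ := H.orderEmbOfFin hH
  have hvinj : Function.Injective v := (H.orderEmbOfFin hH).injective
  have hface : ∀ p, (fun j => pts (v j)) ∈ g (G p c) := by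
    intro p
    have hvp : v p ∈ H := Finset.orderEmbOfFin_mem H hH p
    have hcard : (H.erase (v p)).card = m := by rw [Finset.card_erase_of_mem hvp, hH]; rfl
    have h1 := hχ (H.erase (v p)) hcard p (pts (v p))
    rw [hHc _ (Finset.erase_subset _ _) hcard] at h1
    have h2 : (fun j => v (p.succAbove j)) = (H.erase (v p)).orderEmbOfFin hcard := by
      refine Finset.orderEmbOfFin_unique hcard (fun j => ?_) ?_
      · exact Finset.mem_erase.2 ⟨fun h => Fin.succAbove_ne p j (hvinj h),
          Finset.orderEmbOfFin_mem H hH _⟩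
      · exact (H.orderEmbOfFin hH).strictMono.comp (Fin.strictMono_succAbove p)
    convert h1 using 1
    funext j
    by_cases hj : j = p
    · rw [hj, Fin.insertNth_apply_same]
    · obtain ⟨k, rfl⟩ := Fin.exists_succAbove_eq hj
      rw [Fin.insertNth_apply_succAbove]
      exact congrArg pts (congrFun h2 k)
  have hinter : ∀ T : Finset (Fin (m + 1)), (fun j => pts (v j)) ∈ g {M | ∀ p ∈ T, M ∈ G p c} := by
    intro T
    induction T using Finset.induction_on with
    | empty => exact gmono (G i₀ c) _ (fun M _ => by simp) (hface i₀)
    | insert a T ha ih =>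
      refine gmono (G a c ∩ {M | ∀ p ∈ T, M ∈ G p c}) _ ?_ (by rw [gi]; exact ⟨hface a, ih⟩)
      rintro M ⟨h1, h2⟩ p hp
      obtain rfl | hp := Finset.mem_insert.1 hp
      · exact h1
      · exact h2 p hp
  have hempty : {M : FaceType (m + 1) ok | ∀ p ∈ Finset.univ, M ∈ G p c} = ∅ := by
    refine Set.eq_empty_of_forall_notMem fun M hM => ?_
    obtain ⟨p, q, -, a, ha, b, hb, hab⟩ := M.cons (by
      intro j k hjk
      obtain ⟨p, hpj, hpk⟩ := Fin.exists_ne_and_ne_of_two_lt j k (by omega)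
      obtain ⟨a, ha, -⟩ := hM p (Finset.mem_univ p)
      exact good_of_lab ha j k hpj.symm hpk.symm hjk)
    obtain ⟨a', ha', hac⟩ := hM p (Finset.mem_univ p)
    obtain ⟨b', hb', hbc⟩ := hM q (Finset.mem_univ q)
    rw [Option.mem_def, ha', Option.some_inj] at ha
    rw [Option.mem_def, hb', Option.some_inj] at hb
    exact hκ a b hab (by rw [← ha, ← hb, hac, hbc])
  have := hinter Finset.univ
  rw [hempty, g0] at this
  exact this

end FaceType
/-- `ok₁`-related pairs of labels can be lifted to `ok₂`-related pairs with the same images,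
even if the first component of the lift is prescribed. -/
structure LiftsPairs {L₁ L₂ Q : Type} (ok₁ : L₁ → L₁ → Prop) (ok₂ : L₂ → L₂ → Prop)
    (f₁ : L₁ → Q) (f₂ : L₂ → Q) : Prop where
  symm₁ : ∀ a b, ok₁ a b → ok₁ b a
  symm₂ : ∀ a b, ok₂ a b → ok₂ b a
  lift : ∀ b, ∃ y, f₂ y = f₁ b
  lift_pair : ∀ a b x, ok₁ a b → f₂ x = f₁ a → ∃ y, ok₂ x y ∧ f₂ y = f₁ b

namespace FaceType

/-- Two face types agree after applying `f₁` and `f₂` to their labels. -/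
def Similar {n : ℕ} {L₁ L₂ Q : Type} {ok₁ : L₁ → L₁ → Prop} {ok₂ : L₂ → L₂ → Prop}
    (f₁ : L₁ → Q) (f₂ : L₂ → Q) (M : FaceType n ok₁) (N : FaceType n ok₂) : Prop :=
  M.rel = N.rel ∧ ∀ p, (M.lab p).map f₁ = (N.lab p).map f₂

section Similar

variable {n : ℕ} {L₁ L₂ L₃ Q R : Type} {ok₁ : L₁ → L₁ → Prop} {ok₂ : L₂ → L₂ → Prop}
  {ok₃ : L₃ → L₃ → Prop} {f₁ : L₁ → Q} {f₂ : L₂ → Q} {f₃ : L₃ → Q}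

theorem Similar.symm {M : FaceType n ok₁} {N : FaceType n ok₂} (h : Similar f₁ f₂ M N) :
    Similar f₂ f₁ N M := ⟨h.1.symm, fun p => (h.2 p).symm⟩

theorem Similar.trans {M : FaceType n ok₁} {N : FaceType n ok₂} {P : FaceType n ok₃}
    (h : Similar f₁ f₂ M N) (h' : Similar f₂ f₃ N P) : Similar f₁ f₃ M P :=
  ⟨h.1.trans h'.1, fun p => (h.2 p).trans (h'.2 p)⟩

theorem Similar.comp {M : FaceType n ok₁} {N : FaceType n ok₂}
    (h : Similar f₁ f₂ M N) (g : Q → R) : Similar (g ∘ f₁) (g ∘ f₂) M N :=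
  ⟨h.1, fun p => by rw [← Option.map_map, ← Option.map_map, h.2 p]⟩

/-- Face types can be lifted along `LiftsPairs` with one prescribed face. -/
theorem exists_similar (h : LiftsPairs ok₁ ok₂ f₁ f₂) (N : FaceType n ok₁) (i : Fin n)
    {x : Option L₂} (hx : x.map f₂ = (N.lab i).map f₁) :
    ∃ M : FaceType n ok₂, M.lab i = x ∧ Similar f₂ f₁ M N := by
  classical
  choose sec hsec using h.lift
  let lab : Fin n → Option L₂ := fun r => if N.rel r i then x else (N.lab r).map sec
  have hlab : ∀ r, (lab r).map f₂ = (N.lab r).map f₁ := by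
    intro r
    by_cases hr : N.rel r i
    · simp [lab, hr, hx, N.lab_rel r i hr]
    · simp [lab, hr, Function.comp_def, hsec]
  have hnone : ∀ l : Fin n → Option L₂, (∀ r, (l r).map f₂ = (N.lab r).map f₁) →
      ∀ r, l r = none ↔ ¬ GoodFace N.rel r := by
    intro l hl r
    rw [← N.lab_none, ← Option.map_eq_none_iff (f := f₂), hl, Option.map_eq_none_iff]
  have hlabi : lab i = x := if_pos (N.eqv.refl i)
  by_cases ht : ∀ p q, N.rel p q → p = q
  swap
  · refine ⟨⟨N.rel, N.eqv, lab, hnone lab hlab, fun p q hpq => ?_, fun h => absurd h ht⟩,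
      hlabi, rfl, hlab⟩
    have e1 : N.rel p i ↔ N.rel q i :=
      ⟨fun hr => N.eqv.trans (N.eqv.symm hpq) hr, fun hr => N.eqv.trans hpq hr⟩
    simp only [lab, e1, N.lab_rel p q hpq]
  obtain ⟨p, q, hpq, hqi, a, ha, b, hb, hab⟩ : ∃ p q, p ≠ q ∧ q ≠ i ∧ ∃ a ∈ N.lab p,
      ∃ b ∈ N.lab q, ok₁ a b := by
    obtain ⟨p, q, hpq, a, ha, b, hb, hab⟩ := N.cons ht
    by_cases hqi : q = i
    · exact ⟨q, p, hpq.symm, hqi ▸ hpq, b, hb, a, ha, h.symm₁ _ _ hab⟩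
    · exact ⟨p, q, hpq, hqi, a, ha, b, hb, hab⟩
  rw [Option.mem_def] at ha hb
  obtain ⟨z, hz⟩ : ∃ z, lab p = some z := by
    rw [← Option.ne_none_iff_exists']
    intro hp
    have := hlab p
    simp [hp, ha] at this
  have hza : f₂ z = f₁ a := by simpa [hz, ha] using hlab p
  obtain ⟨y, hzy, hy⟩ := h.lift_pair a b z hab hza
  have hlab' : ∀ r, (Function.update lab q (some y) r).map f₂ = (N.lab r).map f₁ := by
    intro r
    by_cases hr : r = q
    · subst hr
      simp [hb, hy]
    · rw [Function.update_of_ne hr, hlab]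
  refine ⟨⟨N.rel, N.eqv, Function.update lab q (some y), hnone _ hlab',
    fun r r' hr => by rw [ht r r' hr], fun _ => ⟨p, q, hpq, z, ?_, y, ?_, hzy⟩⟩, ?_, rfl, hlab'⟩
  · rw [Function.update_of_ne hpq, hz]; rfl
  · rw [Function.update_self]; rfl
  · change Function.update lab q (some y) i = x
    rw [Function.update_of_ne hqi.symm, hlabi]

theorem exists_similar' (hn : 0 < n) (h : LiftsPairs ok₁ ok₂ f₁ f₂) (N : FaceType n ok₁) :
    ∃ M : FaceType n ok₂, Similar f₂ f₁ M N := by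
  choose sec hsec using h.lift
  obtain ⟨M, -, hM⟩ := exists_similar h N ⟨0, hn⟩ (x := (N.lab ⟨0, hn⟩).map sec) (by
    simp [Function.comp_def, hsec])
  exact ⟨M, hM⟩

theorem Similar.adj_lift (h : LiftsPairs ok₁ ok₂ f₁ f₂) {N N' : FaceType n ok₁}
    {M' : FaceType n ok₂} {i : Fin n} (hN : Adj i N N') (hM' : Similar f₂ f₁ M' N') :
    ∃ M, Adj i M M' ∧ Similar f₂ f₁ M N := by
  obtain ⟨M, hM, hMN⟩ := exists_similar h N i (x := M'.lab i) (by rw [hM'.2, hN.2])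
  exact ⟨M, ⟨fun j k hj hk => by rw [hMN.1, hM'.1]; exact hN.1 j k hj hk, hM⟩, hMN⟩

end Similar

instance {n : ℕ} {L : Type} [Countable L] (ok : L → L → Prop) : Countable (FaceType n ok) := by
  have : Function.Injective fun M : FaceType n ok => (M.rel, M.lab) := by
    intro M N h
    simp only [Prod.mk.injEq] at h
    exact ext_of_le h.1 fun p a hp => by rw [← h.2, hp]
  exact this.countable

end FaceType

/-- Compatibility of labels, including the limit labels `(c, none)`. -/
def okLim {C : Type} (a b : C × Option (ℕ × Bool)) : Prop :=
  a.1 ≠ b.1 ∨ (a.2 = none ∧ b.2 = none) ∨ ∃ m β, a.2 = some (m, β) ∧ b.2 = some (m, !β)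

/-- Inclusion of the labels into the labels with limits. -/
def embLim {C : Type} (a : C × (ℕ × Bool)) : C × Option (ℕ × Bool) := (a.1, some a.2)

/-- Compatibility of labels. -/
def okFin {C : Type} (a b : C × (ℕ × Bool)) : Prop := okLim (embLim a) (embLim b)

/-- Collapse all labels with index at least `k` to the limit labels. -/
def trunc {C : Type} (k : ℕ) (a : C × Option (ℕ × Bool)) : C × Option (ℕ × Bool) :=
  (a.1, a.2.filter fun v => v.1 < k)

theorem okLim_symm {C : Type} (a b : C × Option (ℕ × Bool)) (h : okLim a b) : okLim b a := by
  obtain h | ⟨h, h'⟩ | ⟨m, β, h, h'⟩ := h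
  · exact Or.inl h.symm
  · exact Or.inr (Or.inl ⟨h', h⟩)
  · exact Or.inr (Or.inr ⟨m, !β, h', by simpa using h⟩)

theorem trunc_comp {C : Type} {k l : ℕ} (h : k ≤ l) :
    trunc (C := C) k ∘ trunc l = trunc k := by
  funext ⟨c, v⟩
  cases v with
  | none => rfl
  | some v =>
    simp only [trunc, Function.comp_apply, Option.filter_filter]
    congr 2
    funext w
    grind

theorem okFin_exists {C : Type} (a : C × (ℕ × Bool)) : ∃ b, okFin a b :=
  ⟨(a.1, a.2.1, !a.2.2), Or.inr (Or.inr ⟨a.2.1, a.2.2, rfl, rfl⟩)⟩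

theorem liftsPairs_lim_fin {C : Type} (k : ℕ) :
    LiftsPairs (okLim (C := C)) okFin (trunc k) (trunc k ∘ embLim) where
  symm₁ := okLim_symm
  symm₂ _ _ h := okLim_symm _ _ h
  lift := by
    rintro ⟨c, _ | v⟩
    · exact ⟨(c, k, false), by simp [trunc, embLim]⟩
    · exact ⟨(c, v), rfl⟩
  lift_pair := by
    rintro ⟨c, v⟩ ⟨d, w⟩ ⟨c', m', β'⟩ hok hx
    obtain ⟨rfl, hx⟩ : c' = c ∧ _ := by simpa [trunc, embLim] using hx
    by_cases hcd : c' = d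
    swap
    · obtain ⟨y, hy⟩ : ∃ y : C × (ℕ × Bool), (trunc k ∘ embLim) y = trunc k (d, w) := by
        cases w with
        | none => exact ⟨(d, k, false), by simp [trunc, embLim]⟩
        | some w => exact ⟨(d, w), rfl⟩
      refine ⟨y, Or.inl ?_, hy⟩
      have : y.1 = d := congrArg Prod.fst hy
      rwa [← this] at hcd
    · refine ⟨(d, m', !β'), Or.inr (Or.inr ⟨m', β', rfl, rfl⟩), ?_⟩
      obtain h | ⟨rfl, rfl⟩ | ⟨m, β, rfl, rfl⟩ := hok
      · exact absurd hcd h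
      all_goals
        simp only [trunc, embLim, Function.comp_apply, Option.filter] at hx ⊢
        grind

theorem liftsPairs_lim_lim {C : Type} (k : ℕ) :
    LiftsPairs (okLim (C := C)) okLim (trunc k) (trunc k) where
  symm₁ := okLim_symm
  symm₂ := okLim_symm
  lift b := ⟨b, rfl⟩
  lift_pair := by
    rintro ⟨c, v⟩ ⟨d, w⟩ ⟨c', v'⟩ hok hx
    obtain ⟨rfl, hx⟩ : c' = c ∧ _ := by simpa [trunc] using hx
    by_cases hcd : c' = d
    swap
    · exact ⟨(d, w), Or.inl hcd, rfl⟩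
    · refine ⟨(d, v'.map fun z => (z.1, !z.2)), ?_, ?_⟩
      · cases v' with
        | none => exact Or.inr (Or.inl ⟨rfl, rfl⟩)
        | some z => exact Or.inr (Or.inr ⟨z.1, z.2, rfl, rfl⟩)
      · obtain h | ⟨rfl, rfl⟩ | ⟨m, β, rfl, rfl⟩ := hok
        · exact absurd hcd h
        all_goals
          simp only [trunc, Option.filter] at hx ⊢
          grind

theorem LiftsPairs.comp {L₀ L₁ L₂ Q : Type} {ok₁ : L₁ → L₁ → Prop} {ok₂ : L₂ → L₂ → Prop}
    {f₁ : L₁ → Q} {f₂ : L₂ → Q} (h : LiftsPairs ok₁ ok₂ f₁ f₂) (e : L₀ → L₁) :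
    LiftsPairs (fun a b => ok₁ (e a) (e b)) ok₂ (f₁ ∘ e) f₂ where
  symm₁ _ _ := h.symm₁ _ _
  symm₂ := h.symm₂
  lift b := h.lift (e b)
  lift_pair a b x := h.lift_pair (e a) (e b) x

theorem liftsPairs_fin_fin {C : Type} (k : ℕ) :
    LiftsPairs (okFin (C := C)) okFin (trunc k ∘ embLim) (trunc k ∘ embLim) :=
  (liftsPairs_lim_fin k).comp embLim

theorem liftsPairs_fin_lim {C : Type} (k : ℕ) :
    LiftsPairs (okFin (C := C)) okLim (trunc k ∘ embLim) (trunc k) :=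
  (liftsPairs_lim_lim k).comp embLim

/-- Two of the faces of `H` have compatible labels. -/
def FaceConsistent {n : ℕ} (Λ : Finset ℕ → Fin n × Option (ℕ × Bool)) (H : Finset ℕ) : Prop :=
  ∃ x ∈ H, ∃ y ∈ H, x ≠ y ∧ okLim (Λ (H.erase x)) (Λ (H.erase y))

/-- All `n`-element sets of numbers below `u` are consistent. -/
def ConsistentBelow {n : ℕ} (u : ℕ) (Λ : Finset ℕ → Fin n × Option (ℕ × Bool)) : Prop :=
  ∀ H : Finset ℕ, H.card = n → (∀ x ∈ H, x < u) → FaceConsistent Λ H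

/-- The label function `Λ` leaves room for `w i` as a new point such that `w` has type `N`. -/
structure Feasible {n : ℕ} (Λ : Finset ℕ → Fin n × Option (ℕ × Bool))
    (N : FaceType n (okLim (C := Fin n))) (i : Fin n) (w : Fin n → ℕ) : Prop where
  rel_iff : ∀ j k, N.rel j k ↔ w j = w k
  lt : ∀ j, j ≠ i → w j < w i
  lab : ∀ a, N.lab i = some a → Λ ((Finset.univ.erase i).image w) = a

/-- The labels of the faces of the sequence `w` agree with the type `N`. -/
def Realises {n : ℕ} (Λ : Finset ℕ → Fin n × Option (ℕ × Bool))
    (N : FaceType n (okLim (C := Fin n))) (w : Fin n → ℕ) : Prop :=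
  ∀ p a, N.lab p = some a → Λ ((Finset.univ.erase p).image w) = a

theorem ConsistentBelow.succ {n : ℕ} (hn : 2 < n) {u : ℕ}
    {Λ : Finset ℕ → Fin n × Option (ℕ × Bool)} (hΛ : ConsistentBelow u Λ) (c : Fin n)
    (g : Finset ℕ → Option (Fin n × Option (ℕ × Bool))) (hg : ∀ S a, g S = some a → a.1 ≠ c)
    {Λ' : Finset ℕ → Fin n × Option (ℕ × Bool)}
    (h1 : ∀ S, u ∉ S → Λ' S = Λ S) (h2 : ∀ S, u ∈ S → Λ' S = (g S).getD (c, none))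
    (h : ∀ H : Finset ℕ, H.card = n → u ∈ H → (∀ x ∈ H, x ≠ u → g (H.erase x) ≠ none) →
      FaceConsistent Λ' H) : ConsistentBelow (u + 1) Λ' := by
  intro H hH hu
  by_cases huH : u ∈ H
  swap
  · obtain ⟨x, hx, y, hy, hxy, hok⟩ := hΛ H hH fun x hx =>
      lt_of_le_of_ne (Nat.lt_succ_iff.1 (hu x hx)) fun h => huH (h ▸ hx)
    refine ⟨x, hx, y, hy, hxy, ?_⟩
    rwa [h1 _ fun h => huH (Finset.mem_of_mem_erase h),
      h1 _ fun h => huH (Finset.mem_of_mem_erase h)]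
  by_cases hall : ∀ x ∈ H, x ≠ u → g (H.erase x) ≠ none
  · exact h H hH huH hall
  push Not at hall
  obtain ⟨x, hx, hxu, hgx⟩ := hall
  obtain ⟨y, hy, hyu⟩ : ∃ y ∈ H.erase x, y ≠ u := by
    refine Finset.exists_mem_ne ?_ u
    rw [Finset.card_erase_of_mem hx]
    omega
  have hy' := Finset.mem_of_mem_erase hy
  refine ⟨y, hy', x, hx, Finset.ne_of_mem_erase hy, ?_⟩
  rw [h2 _ (Finset.mem_erase.2 ⟨hyu.symm, huH⟩), h2 _ (Finset.mem_erase.2 ⟨hxu.symm, huH⟩), hgx]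
  cases hgy : g (H.erase y) with
  | none => exact Or.inr (Or.inl ⟨rfl, rfl⟩)
  | some a => exact Or.inl (hg _ _ hgy)

theorem exists_label_step {n : ℕ} (hn : 2 < n) {u : ℕ}
    {Λ : Finset ℕ → Fin n × Option (ℕ × Bool)} (hΛ : ConsistentBelow u Λ)
    (N : FaceType n (okLim (C := Fin n))) (i : Fin n) (w : Fin n → ℕ) (hw : w i = u) :
    ∃ Λ' : Finset ℕ → Fin n × Option (ℕ × Bool), ConsistentBelow (u + 1) Λ' ∧
      (∀ S, u ∉ S → Λ' S = Λ S) ∧ (Feasible Λ N i w → Realises Λ' N w) := by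
  classical
  by_cases hf : Feasible Λ N i w
  swap
  · let Λ' : Finset ℕ → Fin n × Option (ℕ × Bool) := fun S => if u ∈ S then (i, none) else Λ S
    refine ⟨Λ', hΛ.succ hn i (fun _ => none) (fun S a h => by simp at h) (fun S hS => if_neg hS)
      (fun S hS => if_pos hS) ?_, fun S hS => if_neg hS, fun h => absurd h hf⟩
    intro H hH hu h
    obtain ⟨x, hx, hxu⟩ := Finset.exists_mem_ne (s := H) (by omega) u
    exact absurd rfl (h x hx hxu)
  have hne : ∀ j, j ≠ i → w j ≠ u := fun j hj => by
    have := hf.lt j hj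
    omega
  have hu : u ∉ (Finset.univ.erase i).image w := by
    simpa [Finset.mem_image] using hne
  let P : Finset ℕ → Fin n × Option (ℕ × Bool) → Prop := fun S a =>
    ∃ p, p ≠ i ∧ S = (Finset.univ.erase p).image w ∧ N.lab p = some a
  have hP : ∀ S a b, P S a → P S b → a = b := by
    rintro S a b ⟨p, hpi, rfl, ha⟩ ⟨q, hqi, hS, hb⟩
    by_cases hpq : p = q
    · subst hpq
      exact Option.some_injective _ (ha.symm.trans hb)
    · have hp : w p ∈ (Finset.univ.erase p).image w := by
        rw [hS]
        exact Finset.mem_image_of_mem w (by simp [hpq])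
      obtain ⟨r, hr, hrp⟩ := Finset.mem_image.1 hp
      have hrp' := (hf.rel_iff r p).2 hrp
      have hrp'' : r ≠ p := Finset.ne_of_mem_erase hr
      by_cases hrq : r = q
      · rw [hrq] at hrp'
        rw [N.lab_rel q p hrp', ha] at hb
        exact Option.some_injective _ hb
      · exact absurd (FaceType.good_of_lab hb r p hrq hpq hrp') hrp''
  obtain ⟨c, hc⟩ : ∃ c : Fin n, ∀ p a, p ≠ i → N.lab p = some a → a.1 ≠ c := by
    by_contra! hcon
    choose p a hp ha hc using hcon
    have hinj : Function.Injective p := fun c c' h => by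
      have h1 := ha c
      rw [h, ha c'] at h1
      rw [← hc c, ← hc c', Option.some_injective _ h1]
    obtain ⟨c, hci⟩ := Finite.surjective_of_injective hinj i
    exact hp c hci
  let g : Finset ℕ → Option (Fin n × Option (ℕ × Bool)) := fun S =>
    if h : ∃ a, P S a then some h.choose else none
  have hgP : ∀ S a, g S = some a ↔ P S a := by
    intro S a
    by_cases h : ∃ a, P S a
    · simp only [g, dif_pos h, Option.some.injEq]
      exact ⟨fun h' => h' ▸ h.choose_spec, hP _ _ _ h.choose_spec⟩
    · simp only [g, dif_neg h]
      exact ⟨fun h' => by simp at h', fun h' => absurd ⟨a, h'⟩ h⟩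
  let Λ' : Finset ℕ → Fin n × Option (ℕ × Bool) := fun S =>
    if u ∈ S then (g S).getD (c, none) else Λ S
  have h1 : ∀ S, u ∉ S → Λ' S = Λ S := fun S hS => if_neg hS
  have h2 : ∀ S, u ∈ S → Λ' S = (g S).getD (c, none) := fun S hS => if_pos hS
  have hreal : Realises Λ' N w := by
    intro p a ha
    by_cases hp : p = i
    · subst hp
      rw [h1 _ hu, hf.lab a ha]
    · rw [h2, (hgP _ _).2 ⟨p, hp, rfl, ha⟩]
      · rfl
      · exact hw ▸ Finset.mem_image_of_mem w (by simp [Ne.symm hp])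
  refine ⟨Λ', hΛ.succ hn c g ?_ h1 h2 ?_, h1, fun _ => hreal⟩
  · intro S a h
    obtain ⟨p, hp, -, ha⟩ := (hgP S a).1 h
    exact hc p a hp ha
  intro H hH huH hall
  have hsub : ∀ x ∈ H, x ≠ u → H.erase x ⊆ Finset.univ.image w := by
    intro x hx hxu
    obtain ⟨a, ha⟩ := Option.ne_none_iff_exists'.1 (hall x hx hxu)
    obtain ⟨p, -, hS, -⟩ := (hgP _ _).1 ha
    rw [hS]
    exact Finset.image_subset_image (Finset.subset_univ _)
  have hHw : H = Finset.univ.image w := by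
    refine Finset.eq_of_subset_of_card_le ?_ ?_
    · intro y hy
      obtain ⟨x, hx, hxu⟩ : ∃ x ∈ H.erase y, x ≠ u := by
        refine Finset.exists_mem_ne ?_ u
        rw [Finset.card_erase_of_mem hy]
        omega
      exact hsub x (Finset.mem_of_mem_erase hx) hxu
        (Finset.mem_erase.2 ⟨(Finset.ne_of_mem_erase hx).symm, hy⟩)
    · rw [hH]
      exact Finset.card_image_le.trans (by simp)
  have hinj : Function.Injective w := by
    have : Set.InjOn w (Finset.univ : Finset (Fin n)) :=
      Finset.card_image_iff.1 (by rw [← hHw, hH, Finset.card_univ, Fintype.card_fin])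
    rwa [Finset.coe_univ, Set.injOn_univ] at this
  obtain ⟨p, q, hpq, a, ha, b, hb, hab⟩ := N.cons fun p q h => hinj ((hf.rel_iff p q).1 h)
  refine ⟨w p, hHw ▸ Finset.mem_image_of_mem w (Finset.mem_univ p), w q,
    hHw ▸ Finset.mem_image_of_mem w (Finset.mem_univ q), hinj.ne hpq, ?_⟩
  rw [hHw, ← Finset.image_erase hinj, ← Finset.image_erase hinj, hreal p a ha, hreal q b hb]
  exact hab

/-- There is a universal consistent label function on the `(n - 1)`-element sets of numbers. -/
theorem exists_universal_labelling {n : ℕ} (hn : 2 < n) :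
    ∃ Λ : Finset ℕ → Fin n × Option (ℕ × Bool),
      (∀ H : Finset ℕ, H.card = n → FaceConsistent Λ H) ∧
      ∀ (N : FaceType n (okLim (C := Fin n))) (i : Fin n) (s : Fin n → ℕ),
        (∀ j k, j ≠ i → k ≠ i → (N.rel j k ↔ s j = s k)) → (∀ j, j ≠ i → ¬ N.rel i j) →
        (∀ a, N.lab i = some a → Λ ((Finset.univ.erase i).image s) = a) →
        ∃ u, (∀ j k, N.rel j k ↔ Function.update s i u j = Function.update s i u k) ∧
          Realises Λ N (Function.update s i u) := by
  obtain ⟨t, ht⟩ : ∃ t : ℕ → FaceType n (okLim (C := Fin n)) × Fin n × (Fin n → ℕ),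
      ∀ τ b, ∃ u, b < u ∧ t u = τ := by
    have : Nonempty (FaceType n (okLim (C := Fin n))) :=
      ⟨⟨fun _ _ => True, ⟨fun _ => trivial, fun _ => trivial, fun _ _ => trivial⟩, fun _ => none,
        fun p => by
          simp only [true_iff]
          intro h
          obtain ⟨j, hj, k, hk, hjk⟩ := Finset.one_lt_card.1
            (show 1 < (Finset.univ.erase p).card by
              rw [Finset.card_erase_of_mem (Finset.mem_univ p), Finset.card_univ, Fintype.card_fin]
              omega)
          exact hjk (h j k (Finset.ne_of_mem_erase hj) (Finset.ne_of_mem_erase hk) trivial),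
        fun _ _ _ => rfl,
        fun h => absurd (h ⟨0, by omega⟩ ⟨1, by omega⟩ trivial) (by simp)⟩⟩
    have : Nonempty (Fin n) := ⟨⟨0, by omega⟩⟩
    obtain ⟨e, he⟩ := exists_surjective_nat
      ((FaceType n (okLim (C := Fin n)) × Fin n × (Fin n → ℕ)) × ℕ)
    refine ⟨fun u => (e u).1, fun τ b => ?_⟩
    choose m hm using fun k => he (τ, k)
    have hinj : Function.Injective m := fun k l h => by
      have h1 := hm k
      rw [h, hm l] at h1
      exact (congrArg Prod.snd h1).symm
    obtain ⟨u, hu, hb⟩ := (Set.infinite_of_injective_forall_mem (s := {u | (e u).1 = τ}) hinj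
      fun k => by simp [hm]).exists_gt b
    exact ⟨u, hb, hu⟩
  choose next hnext hagree hreal using
    fun (u : ℕ) (Λ : {Λ : Finset ℕ → Fin n × Option (ℕ × Bool) // ConsistentBelow u Λ}) =>
      exists_label_step hn Λ.2 (t u).1 (t u).2.1 (Function.update (t u).2.2 (t u).2.1 u) (by simp)
  let stage : (u : ℕ) → {Λ : Finset ℕ → Fin n × Option (ℕ × Bool) // ConsistentBelow u Λ} :=
    fun u => Nat.rec (motive := fun u =>
        {Λ : Finset ℕ → Fin n × Option (ℕ × Bool) // ConsistentBelow u Λ})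
      ⟨fun _ => (⟨0, by omega⟩, none), fun H hH h => by
        obtain ⟨x, hx⟩ := Finset.card_pos.1 (show 0 < H.card by omega)
        exact absurd (h x hx) (Nat.not_lt_zero x)⟩
      (fun u Λ => ⟨next u Λ, hnext u Λ⟩) u
  have hstage : ∀ l l' S, l ≤ l' → (∀ x ∈ S, x < l) → (stage l').1 S = (stage l).1 S := by
    intro l l' S hl hS
    induction l', hl using Nat.le_induction with
    | base => rfl
    | succ l' hl ih => exact (hagree l' (stage l') S fun h => absurd (hS _ h) (by omega)).trans ih
  let Λ : Finset ℕ → Fin n × Option (ℕ × Bool) := fun S => (stage (S.sup id + 1)).1 S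
  have hsup : ∀ (S : Finset ℕ), ∀ x ∈ S, x < S.sup id + 1 := fun S x hx =>
    Nat.lt_succ_of_le (Finset.le_sup (f := id) hx)
  have hΛ : ∀ l S, (∀ x ∈ S, x < l) → Λ S = (stage l).1 S := by
    intro l S hS
    obtain h | h := le_total l (S.sup id + 1)
    · exact hstage _ _ S h hS
    · exact (hstage _ _ S h (hsup S)).symm
  refine ⟨Λ, fun H hH => ?_, fun N i s h1 h2 h3 => ?_⟩
  · obtain ⟨x, hx, y, hy, hxy, hok⟩ := (stage (H.sup id + 1)).2 H hH (hsup H)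
    refine ⟨x, hx, y, hy, hxy, ?_⟩
    rwa [hΛ _ _ fun z hz => hsup H z (Finset.mem_of_mem_erase hz),
      hΛ _ _ fun z hz => hsup H z (Finset.mem_of_mem_erase hz)]
  · obtain ⟨u, hu, htu⟩ := ht (N, i, s) (Finset.univ.sup s)
    have hlt : ∀ j, s j < u := fun j => (Finset.le_sup (Finset.mem_univ j)).trans_lt hu
    have himage : (Finset.univ.erase i).image (Function.update s i u) =
        (Finset.univ.erase i).image s :=
      Finset.image_congr fun j hj => Function.update_of_ne (Finset.ne_of_mem_erase hj) _ _
    have hrel : ∀ j k, N.rel j k ↔ Function.update s i u j = Function.update s i u k := by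
      intro j k
      by_cases hj : j = i
      · subst hj
        by_cases hk : k = j
        · subst hk
          simp [N.eqv.refl k]
        · rw [Function.update_self, Function.update_of_ne hk]
          exact ⟨fun h => absurd h (h2 k hk), fun h => absurd h (hlt k).ne'⟩
      · by_cases hk : k = i
        · subst hk
          rw [Function.update_self, Function.update_of_ne hj]
          exact ⟨fun h => absurd (N.eqv.symm h) (h2 j hj), fun h => absurd h (hlt j).ne⟩
        · rw [Function.update_of_ne hj, Function.update_of_ne hk]
          exact h1 j k hj hk
    have hr := hreal u (stage u)
    rw [htu] at hr
    refine ⟨u, hrel, fun p a ha => ?_⟩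
    have hpos : ∀ x ∈ (Finset.univ.erase p).image (Function.update s i u), x < u + 1 := by
      intro x hx
      obtain ⟨j, -, rfl⟩ := Finset.mem_image.1 hx
      by_cases hj : j = i
      · subst hj
        simp
      · rw [Function.update_of_ne hj]
        exact (hlt j).trans (Nat.lt_succ_self u)
    rw [hΛ (u + 1) _ hpos]
    refine hr ⟨hrel, fun j hj => ?_, fun a ha => ?_⟩ p a ha
    · simpa [Function.update_of_ne hj] using hlt j
    · change (stage u).1 ((Finset.univ.erase i).image (Function.update s i u)) = a
      rw [himage, ← hΛ u _ ?_, h3 a ha]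
      intro x hx
      obtain ⟨j, -, rfl⟩ := Finset.mem_image.1 hx
      exact hlt j

namespace FaceType

/-- The type of a sequence of numbers, given a consistent label function. -/
noncomputable def ofSeq {n : ℕ} (Λ : Finset ℕ → Fin n × Option (ℕ × Bool))
    (hΛ : ∀ H : Finset ℕ, H.card = n → FaceConsistent Λ H) (s : Fin n → ℕ) :
    FaceType n (okLim (C := Fin n)) where
  rel i j := s i = s j
  eqv := ⟨fun _ => rfl, fun h => h.symm, fun h h' => h.trans h'⟩
  lab p := open Classical in
    if GoodFace (fun i j => s i = s j) p then some (Λ ((Finset.univ.erase p).image s)) else none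
  lab_none p := by simp
  lab_rel p q hpq := by
    have hcongr := goodFace_congr (rel := fun i j => s i = s j)
      ⟨fun _ => rfl, fun h => h.symm, fun h h' => h.trans h'⟩ hpq
    have himage : (Finset.univ.erase p).image s = (Finset.univ.erase q).image s := by
      ext x
      simp only [Finset.mem_image, Finset.mem_erase, Finset.mem_univ, and_true]
      constructor
      · rintro ⟨r, hr, rfl⟩
        by_cases hrq : r = q
        · exact ⟨p, fun h => hr (hrq.trans h.symm), by rw [hrq, hpq]⟩
        · exact ⟨r, hrq, rfl⟩
      · rintro ⟨r, hr, rfl⟩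
        by_cases hrp : r = p
        · exact ⟨q, fun h => hr (hrp.trans h.symm), by rw [hrp, hpq]⟩
        · exact ⟨r, hrp, rfl⟩
    classical
    rw [himage]
    exact if_congr hcongr rfl rfl
  cons h := by
    have hinj : Function.Injective s := fun p q => h p q
    obtain ⟨x, hx, y, hy, hxy, hok⟩ := hΛ (Finset.univ.image s)
      (by rw [Finset.card_image_of_injective _ hinj, Finset.card_univ, Fintype.card_fin])
    obtain ⟨p, -, rfl⟩ := Finset.mem_image.1 hx
    obtain ⟨q, -, rfl⟩ := Finset.mem_image.1 hy
    rw [← Finset.image_erase hinj, ← Finset.image_erase hinj] at hok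
    have hgood : ∀ r, GoodFace (fun i j => s i = s j) r := fun r j k _ _ => h j k
    exact ⟨p, q, fun h => hxy (congrArg s h), _, by simp [hgood p], _,
      by simp [hgood q], hok⟩

theorem adj_ofSeq {n : ℕ} {Λ : Finset ℕ → Fin n × Option (ℕ × Bool)}
    {hΛ : ∀ H : Finset ℕ, H.card = n → FaceConsistent Λ H} {s t : Fin n → ℕ} {i : Fin n}
    (h : ∀ j, j ≠ i → s j = t j) : Adj i (ofSeq Λ hΛ s) (ofSeq Λ hΛ t) := by
  have hrel : ∀ j k, j ≠ i → k ≠ i → (s j = s k ↔ t j = t k) := fun j k hj hk => by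
    rw [h j hj, h k hk]
  have himage : (Finset.univ.erase i).image s = (Finset.univ.erase i).image t :=
    Finset.image_congr fun j hj => h j (Finset.ne_of_mem_erase hj)
  refine ⟨hrel, ?_⟩
  classical
  simp only [ofSeq, himage]
  exact if_congr (goodFace_congr_off hrel) rfl rfl

/-- The label function `Λ` is consistent and every possible change of type is realised. -/
theorem exists_ofSeq {n : ℕ} (hn : 2 < n) :
    ∃ (Λ : Finset ℕ → Fin n × Option (ℕ × Bool))
      (hΛ : ∀ H : Finset ℕ, H.card = n → FaceConsistent Λ H),
      ∀ (N : FaceType n (okLim (C := Fin n))) (i : Fin n) (s : Fin n → ℕ),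
        Adj i N (ofSeq Λ hΛ s) → ∃ u, ofSeq Λ hΛ (Function.update s i u) = N := by
  obtain ⟨Λ, hΛ, H⟩ := exists_universal_labelling hn
  refine ⟨Λ, hΛ, fun N i s hN => ?_⟩
  have hadj : ∀ u, Adj i (ofSeq Λ hΛ (Function.update s i u)) (ofSeq Λ hΛ s) := fun u =>
    adj_ofSeq fun j hj => Function.update_of_ne hj _ _
  by_cases hrel : ∃ j, j ≠ i ∧ N.rel i j
  · obtain ⟨j, hji, hj⟩ := hrel
    refine ⟨s j, ((hadj _).trans hN.symm).eq hji.symm ?_ hj⟩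
    change Function.update s i (s j) i = Function.update s i (s j) j
    rw [Function.update_self, Function.update_of_ne hji]
  · push Not at hrel
    obtain ⟨u, hu, hreal⟩ := H N i s (fun j k hj hk => hN.1 j k hj hk) hrel fun a ha => by
      have := hN.2.symm.trans ha
      simp only [ofSeq, Option.ite_none_right_eq_some, Option.some.injEq] at this
      exact this.2
    refine ⟨u, (ext_of_le (funext₂ fun j k => propext (hu j k)) fun p a ha => ?_).symm⟩
    have hgood := good_of_lab ha
    simp only [ofSeq, Option.ite_none_right_eq_some, Option.some.injEq]
    exact ⟨fun j k hj hk hjk => hgood j k hj hk ((hu j k).2 hjk), hreal p a ha⟩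

end FaceType

namespace FaceType

variable {n : ℕ}

/-- `X` is determined by the equality patterns and the labels truncated at level `k`. -/
def Closed (k : ℕ) (X : Set (FaceType n (okFin (C := Fin n)))) : Prop :=
  ∀ M M', Similar (trunc k ∘ embLim) (trunc k ∘ embLim) M M' → M ∈ X → M' ∈ X

theorem Similar.mono {L₁ L₂ : Type} {ok₁ : L₁ → L₁ → Prop} {ok₂ : L₂ → L₂ → Prop}
    {M : FaceType n ok₁} {N : FaceType n ok₂} {f₁ : L₁ → Fin n × Option (ℕ × Bool)}
    {f₂ : L₂ → Fin n × Option (ℕ × Bool)} {k l : ℕ} (hkl : k ≤ l)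
    (h : Similar (trunc l ∘ f₁) (trunc l ∘ f₂) M N) :
    Similar (trunc k ∘ f₁) (trunc k ∘ f₂) M N := by
  have := h.comp (trunc k)
  rwa [← Function.comp_assoc, ← Function.comp_assoc, trunc_comp hkl] at this

theorem Closed.mono {k l : ℕ} (hkl : k ≤ l) {X : Set (FaceType n (okFin (C := Fin n)))}
    (h : Closed k X) : Closed l X :=
  fun M M' hM => h M M' (hM.mono hkl)

theorem Closed.union {k : ℕ} {X Y : Set (FaceType n (okFin (C := Fin n)))}
    (hX : Closed k X) (hY : Closed k Y) : Closed k (X ∪ Y) :=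
  fun M M' h => Or.imp (hX M M' h) (hY M M' h)

theorem Closed.inter {k : ℕ} {X Y : Set (FaceType n (okFin (C := Fin n)))}
    (hX : Closed k X) (hY : Closed k Y) : Closed k (X ∩ Y) :=
  fun M M' h => And.imp (hX M M' h) (hY M M' h)

theorem Closed.compl {k : ℕ} {X : Set (FaceType n (okFin (C := Fin n)))}
    (hX : Closed k X) : Closed k Xᶜ :=
  fun M M' h hM hM' => hM (hX M' M h.symm hM')

theorem Closed.cyl {k : ℕ} {X : Set (FaceType n (okFin (C := Fin n)))}
    (hX : Closed k X) (i : Fin n) : Closed k {y | ∃ x ∈ X, Adj i x y} := by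
  rintro M M' h ⟨x, hx, hxM⟩
  obtain ⟨x', hx', hsim⟩ := Similar.adj_lift (liftsPairs_fin_fin k) hxM h.symm
  exact ⟨x', hX x x' hsim.symm hx, hx'⟩

theorem exists_closed_singleton (M : FaceType n (okFin (C := Fin n))) : ∃ k, Closed k {M} := by
  obtain ⟨k, hk⟩ : ∃ k, ∀ p a, M.lab p = some a → a.2.1 < k := by
    refine ⟨Finset.univ.sup fun p => (M.lab p).elim 0 fun a => a.2.1 + 1, fun p a ha => ?_⟩
    have := Finset.le_sup (f := fun p => (M.lab p).elim 0 fun a => a.2.1 + 1) (Finset.mem_univ p)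
    rw [ha] at this
    exact this
  refine ⟨k, ?_⟩
  rintro _ M' h rfl
  refine (ext_of_le h.1 fun p a ha => ?_).symm
  have hp := h.2 p
  rw [ha, Option.map_some, eq_comm, Option.map_eq_some_iff] at hp
  obtain ⟨⟨c', v'⟩, hb, hab⟩ := hp
  rw [hb]
  have hka := hk p a ha
  obtain ⟨c, v⟩ := a
  simp only [trunc, embLim, Function.comp_apply, Option.filter] at hab hka ⊢
  grind

theorem exists_closed {X : Set (FaceType n (okFin (C := Fin n)))}
    (hX : InTm Adj (diag okFin) X) : ∃ k, Closed k X := by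
  induction hX with
  | sing M => exact exists_closed_singleton M
  | empty => exact ⟨0, fun _ _ _ h => h⟩
  | univ => exact ⟨0, fun _ _ _ h => h⟩
  | union _ _ hX hY =>
    obtain ⟨k, hX⟩ := hX
    obtain ⟨l, hY⟩ := hY
    exact ⟨max k l, (hX.mono (le_max_left k l)).union (hY.mono (le_max_right k l))⟩
  | inter _ _ hX hY =>
    obtain ⟨k, hX⟩ := hX
    obtain ⟨l, hY⟩ := hY
    exact ⟨max k l, (hX.mono (le_max_left k l)).inter (hY.mono (le_max_right k l))⟩
  | compl _ hX =>
    obtain ⟨k, hX⟩ := hX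
    exact ⟨k, hX.compl⟩
  | cyl i _ hX =>
    obtain ⟨k, hX⟩ := hX
    exact ⟨k, hX.cyl i⟩
  | diag i j => exact ⟨0, fun M M' h (hM : M.rel i j) => show M'.rel i j from h.1 ▸ hM⟩

/-- The types with limit labels all of whose sufficiently good approximations lie in `X`. -/
def limSet (X : Set (FaceType n (okFin (C := Fin n)))) :
    Set (FaceType n (okLim (C := Fin n))) :=
  {N | ∃ k, ∀ M, Similar (trunc k ∘ embLim) (trunc k ∘ id) M N → M ∈ X}

section limSet

variable {k : ℕ} {X Y : Set (FaceType n (okFin (C := Fin n)))}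
  {N : FaceType n (okLim (C := Fin n))}

theorem Closed.mem_limSet_iff_forall (hX : Closed k X) (hn : 0 < n) :
    N ∈ limSet X ↔ ∀ M, Similar (trunc k ∘ embLim) (trunc k) M N → M ∈ X := by
  refine ⟨?_, fun h => ⟨k, h⟩⟩
  rintro ⟨l, hl⟩ M hM
  obtain ⟨M', hM'⟩ := exists_similar' hn (liftsPairs_lim_fin (max k l)) N
  exact hX M' M ((hM'.mono (f₂ := id) (le_max_left k l)).trans hM.symm)
    (hl M' (hM'.mono (f₂ := id) (le_max_right k l)))

theorem Closed.mem_limSet_iff_exists (hX : Closed k X) (hn : 0 < n) :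
    N ∈ limSet X ↔ ∃ M ∈ X, Similar (trunc k ∘ embLim) (trunc k) M N := by
  rw [hX.mem_limSet_iff_forall hn]
  constructor
  · intro h
    obtain ⟨M, hM⟩ := exists_similar' hn (liftsPairs_lim_fin k) N
    exact ⟨M, h M hM, hM⟩
  · rintro ⟨M, hM, hMN⟩ M' hM'
    exact hX M M' (hMN.trans hM'.symm) hM

theorem limSet_union (hn : 0 < n) (hX : InTm Adj (diag okFin) X) (hY : InTm Adj (diag okFin) Y) :
    limSet (X ∪ Y) = limSet X ∪ limSet Y := by
  obtain ⟨k, hX⟩ := exists_closed hX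
  obtain ⟨l, hY⟩ := exists_closed hY
  replace hX := hX.mono (le_max_left k l)
  replace hY := hY.mono (le_max_right k l)
  ext N
  rw [Set.mem_union, hX.mem_limSet_iff_exists hn, hY.mem_limSet_iff_exists hn,
    (hX.union hY).mem_limSet_iff_exists hn]
  simp only [Set.mem_union, or_and_right, exists_or]

theorem limSet_inter (hn : 0 < n) (hX : InTm Adj (diag okFin) X) (hY : InTm Adj (diag okFin) Y) :
    limSet (X ∩ Y) = limSet X ∩ limSet Y := by
  obtain ⟨k, hX⟩ := exists_closed hX
  obtain ⟨l, hY⟩ := exists_closed hY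
  replace hX := hX.mono (le_max_left k l)
  replace hY := hY.mono (le_max_right k l)
  ext N
  rw [Set.mem_inter_iff, hX.mem_limSet_iff_forall hn, hY.mem_limSet_iff_forall hn,
    (hX.inter hY).mem_limSet_iff_forall hn]
  simp only [Set.mem_inter_iff, imp_and, forall_and]

theorem limSet_compl (hn : 0 < n) (hX : InTm Adj (diag okFin) X) :
    limSet Xᶜ = (limSet X)ᶜ := by
  obtain ⟨k, hX⟩ := exists_closed hX
  ext N
  rw [Set.mem_compl_iff, hX.mem_limSet_iff_forall hn, hX.compl.mem_limSet_iff_exists hn]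
  simp only [Set.mem_compl_iff]
  grind

theorem limSet_cyl (hn : 0 < n) (hX : InTm Adj (diag okFin) X) (i : Fin n) :
    limSet {y | ∃ x ∈ X, Adj i x y} = {N | ∃ N' ∈ limSet X, Adj i N' N} := by
  obtain ⟨k, hX⟩ := exists_closed hX
  ext N
  simp only [Set.mem_ofPred_eq, hX.mem_limSet_iff_exists hn, (hX.cyl i).mem_limSet_iff_exists hn]
  constructor
  · rintro ⟨M, ⟨x, hx, hxM⟩, hMN⟩
    obtain ⟨N', hN', hsim⟩ := Similar.adj_lift (liftsPairs_fin_lim k) hxM hMN.symm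
    exact ⟨N', ⟨x, hx, hsim.symm⟩, hN'⟩
  · rintro ⟨N', ⟨x, hx, hxN'⟩, hN'⟩
    obtain ⟨M, hM, hsim⟩ := Similar.adj_lift (liftsPairs_lim_fin k) hN'.symm hxN'
    exact ⟨M, ⟨x, hx, hM.symm⟩, hsim⟩

theorem limSet_diag (hn : 0 < n) (i j : Fin n) :
    limSet (diag (okFin (C := Fin n)) i j) = {N | N.rel i j} := by
  obtain ⟨k, hX⟩ := exists_closed (InTm.diag (T := Adj) (E := diag (okFin (C := Fin n))) i j)
  ext N
  rw [hX.mem_limSet_iff_forall hn]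
  constructor
  · intro h
    obtain ⟨M, hM⟩ := exists_similar' hn (liftsPairs_lim_fin k) N
    have hMX : M.rel i j := h M hM
    rw [hM.1] at hMX
    exact hMX
  · intro (h : N.rel i j) M hM
    exact (hM.1 ▸ h : M.rel i j)

theorem limSet_empty (hn : 0 < n) : limSet (∅ : Set (FaceType n (okFin (C := Fin n)))) = ∅ := by
  ext N
  rw [Closed.mem_limSet_iff_exists (k := 0) (fun _ _ _ h => h) hn]
  simp

theorem limSet_univ : limSet (Set.univ : Set (FaceType n (okFin (C := Fin n)))) = Set.univ :=
  Set.eq_univ_of_forall fun _ => ⟨0, fun _ _ => trivial⟩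

end limSet

theorem lab_eq_none_of_rel {L : Type} {ok : L → L → Prop} (hn : 2 < n) {M : FaceType n ok}
    (h : ∀ i j, M.rel i j) (p : Fin n) : M.lab p = none := by
  rw [M.lab_none]
  intro hp
  obtain ⟨j, hj, k, hk, hjk⟩ := Finset.one_lt_card.1
    (show 1 < (Finset.univ.erase p).card by
      rw [Finset.card_erase_of_mem (Finset.mem_univ p), Finset.card_univ, Fintype.card_fin]
      omega)
  exact hjk (hp j k (Finset.ne_of_mem_erase hj) (Finset.ne_of_mem_erase hk) (h j k))

/-- The term algebra over face types is representable. -/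
theorem tmAlg_representable (hn : 2 < n) :
    (tmAlg (Adj (n := n) (ok := okFin (C := Fin n))) (diag okFin)).Representable := by
  have hn0 : 0 < n := by omega
  obtain ⟨Λ, hΛ, hmove⟩ := exists_ofSeq hn
  let f : Set (FaceType n (okFin (C := Fin n))) → Set (Fin n → ℕ) :=
    fun X => ofSeq Λ hΛ ⁻¹' limSet X
  have hcyl : ∀ (i : Fin n) {X}, InTm Adj (diag okFin) X →
      f {y | ∃ x ∈ X, Adj i x y} = cylSet (Fin n) ℕ i (f X) := by
    intro i X hX
    simp only [f, limSet_cyl hn0 hX]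
    ext s
    constructor
    · rintro ⟨N, hN, hNs⟩
      obtain ⟨u, rfl⟩ := hmove N i s hNs
      exact ⟨_, hN, fun j hj => Function.update_of_ne hj _ _⟩
    · rintro ⟨t, ht, hts⟩
      exact ⟨_, ht, adj_ofSeq hts⟩
  have hne : ∀ (k : ℕ) (X) (M : FaceType n (okFin (C := Fin n))), InTm Adj (diag okFin) X → M ∈ X →
      (∀ i : Fin n, k ≤ i → M.rel i ⟨n - 1, by omega⟩) → (f X).Nonempty := by
    intro k
    induction k with
    | zero =>
      intro X M hX hM hk
      have hrel : ∀ i j, M.rel i j := fun i j =>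
        M.eqv.trans (hk i (Nat.zero_le _)) (M.eqv.symm (hk j (Nat.zero_le _)))
      obtain ⟨k, hX⟩ := exists_closed hX
      refine ⟨fun _ => 0, (hX.mem_limSet_iff_exists hn0).2 ⟨M, hM, ?_, fun p => ?_⟩⟩
      · exact funext₂ fun i j => propext ⟨fun _ => rfl, fun _ => hrel i j⟩
      · rw [lab_eq_none_of_rel hn hrel, lab_eq_none_of_rel hn fun _ _ => rfl]
        rfl
    | succ k ih =>
      intro X M hX hM hk
      by_cases hkn : k < n - 1
      swap
      · refine ih X M hX hM fun i hi => ?_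
        have hi' : i = ⟨n - 1, by omega⟩ := Fin.ext (by simp; omega)
        rw [hi']
        exact M.eqv.refl _
      have : Nonempty (Fin n) := ⟨⟨0, hn0⟩⟩
      obtain ⟨M', hadj, hrel⟩ := exists_adj_rel hn okFin_exists M
        (i := ⟨k, by omega⟩) (j := ⟨n - 1, by omega⟩) (by simp; omega)
      have := ih _ M' (InTm.cyl ⟨k, by omega⟩ hX) ⟨M, hM, hadj.symm⟩ fun i hi => by
        obtain hi | hi := hi.eq_or_lt
        · have hi' : i = ⟨k, by omega⟩ := Fin.ext hi.symm
          rw [hi']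
          exact hrel
        · exact (hadj.1 i _ (by simp [Fin.ext_iff]; omega) (by simp; omega)).2 (hk i hi)
      rw [hcyl _ hX] at this
      obtain ⟨s, t, ht, -⟩ := this
      exact ⟨t, ht⟩
  have hsub : ∀ {X Y}, InTm Adj (diag okFin) X → InTm Adj (diag okFin) Y → f X ⊆ f Y → X ⊆ Y := by
    intro X Y hX hY hXY M hMX
    by_contra hMY
    obtain ⟨s, hs⟩ := hne n (X ∩ Yᶜ) M (hX.inter hY.compl) ⟨hMX, hMY⟩
      fun i hi => absurd i.2 (not_lt.2 hi)
    simp only [f, limSet_inter hn0 hX hY.compl, limSet_compl hn0 hY] at hs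
    exact hs.2 (hXY hs.1)
  refine ⟨Unit, fun _ => ℕ, fun X _ => f X.1, fun X Y h => ?_, fun X Y => ?_, fun X Y => ?_,
    fun X => ?_, ?_, ?_, fun i X => ?_, fun i j => ?_⟩
  · have h' : f X.1 = f Y.1 := congrFun h ()
    exact Subtype.ext ((hsub X.2 Y.2 h'.le).antisymm (hsub Y.2 X.2 h'.ge))
  · exact funext fun _ => congrArg (ofSeq Λ hΛ ⁻¹' ·) (limSet_union hn0 X.2 Y.2)
  · exact funext fun _ => congrArg (ofSeq Λ hΛ ⁻¹' ·) (limSet_inter hn0 X.2 Y.2)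
  · exact funext fun _ => congrArg (ofSeq Λ hΛ ⁻¹' ·) (limSet_compl hn0 X.2)
  · exact funext fun _ => congrArg (ofSeq Λ hΛ ⁻¹' ·) (limSet_empty hn0)
  · exact funext fun _ => congrArg (ofSeq Λ hΛ ⁻¹' ·) limSet_univ
  · exact funext fun _ => hcyl i X.2
  · exact funext fun _ => congrArg (ofSeq Λ hΛ ⁻¹' ·) (limSet_diag hn0 i j)

end FaceType

section TermAlgebra

variable {n : ℕ} {B : Type} {T : Fin n → B → B → Prop} {E : Fin n → Fin n → Set B}

theorem countable_tmAlg [Countable B] : Countable (tmAlg T E).carrier := by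
  let cyl : Fin n → Set B → Set B := fun i X => {y | ∃ x ∈ X, T i x y}
  let step : Set (Set B) → Set (Set B) := fun G =>
    G ∪ (Set.image2 (· ∪ ·) G G ∪ (Set.image2 (· ∩ ·) G G ∪ (compl '' G ∪ ⋃ i, cyl i '' G)))
  let G : ℕ → Set (Set B) := fun k => step^[k]
    (Set.range singleton ∪ ({∅, Set.univ} ∪ Set.range fun p : Fin n × Fin n => E p.1 p.2))
  have hsucc : ∀ k, G (k + 1) = step (G k) := fun k => Function.iterate_succ_apply' _ _ _
  have hcount : ∀ k, (G k).Countable := by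
    intro k
    induction k with
    | zero =>
      exact (Set.countable_range _).union
        ((Set.toFinite {∅, Set.univ}).countable.union (Set.countable_range _))
    | succ k ih =>
      rw [hsucc]
      exact ih.union ((ih.image2 ih _).union ((ih.image2 ih _).union
        ((ih.image _).union (Set.countable_iUnion fun i => ih.image _))))
  have hmono : Monotone G := monotone_nat_of_le_succ fun k => by
    rw [hsucc]
    exact Set.subset_union_left
  have hmem : {X | InTm T E X} ⊆ ⋃ k, G k := by
    intro X hX
    rw [Set.mem_iUnion]
    induction hX with
    | sing b => exact ⟨0, Or.inl ⟨b, rfl⟩⟩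
    | empty => exact ⟨0, Or.inr (Or.inl (Or.inl rfl))⟩
    | univ => exact ⟨0, Or.inr (Or.inl (Or.inr rfl))⟩
    | diag i j => exact ⟨0, Or.inr (Or.inr ⟨(i, j), rfl⟩)⟩
    | union _ _ hX hY =>
      obtain ⟨k, hX⟩ := hX
      obtain ⟨l, hY⟩ := hY
      exact ⟨max k l + 1, hsucc _ ▸ Or.inr (Or.inl (Set.mem_image2_of_mem
        (hmono (le_max_left k l) hX) (hmono (le_max_right k l) hY)))⟩
    | inter _ _ hX hY =>
      obtain ⟨k, hX⟩ := hX
      obtain ⟨l, hY⟩ := hY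
      exact ⟨max k l + 1, hsucc _ ▸ Or.inr (Or.inr (Or.inl (Set.mem_image2_of_mem
        (hmono (le_max_left k l) hX) (hmono (le_max_right k l) hY))))⟩
    | compl _ hX =>
      obtain ⟨k, hX⟩ := hX
      exact ⟨k + 1, hsucc _ ▸ Or.inr (Or.inr (Or.inr (Or.inl ⟨_, hX, rfl⟩)))⟩
    | cyl i _ hX =>
      obtain ⟨k, hX⟩ := hX
      exact ⟨k + 1, hsucc _ ▸ Or.inr (Or.inr (Or.inr (Or.inr
        (Set.mem_iUnion.2 ⟨i, _, hX, rfl⟩))))⟩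
  exact ((Set.countable_iUnion hcount).mono hmem).to_subtype

theorem cmAlg_atomic : (cmAlg T E).Atomic := by
  intro X hX
  obtain ⟨b, hb⟩ := Set.nonempty_iff_ne_empty.2 hX
  exact ⟨({b} : Set B), ⟨Set.singleton_ne_empty b, fun Y hY =>
    Set.subset_singleton_iff_eq.1 (Set.union_eq_right.1 hY)⟩,
    Set.union_eq_right.2 (Set.singleton_subset_iff.2 hb)⟩

theorem tmAlg_atomic : (tmAlg T E).Atomic := by
  intro X hX
  obtain ⟨b, hb⟩ := Set.nonempty_iff_ne_empty.2 fun h => hX (Subtype.ext h)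
  exact ⟨⟨{b}, .sing b⟩, ⟨fun h => Set.singleton_ne_empty b (congrArg Subtype.val h), fun Y hY =>
    (Set.subset_singleton_iff_eq.1 (Set.union_eq_right.1 (congrArg Subtype.val hY))).imp
      (fun h => Subtype.ext h) fun h => Subtype.ext h⟩,
    Subtype.ext (Set.union_eq_right.2 (Set.singleton_subset_iff.2 hb))⟩

theorem tmAlg_isCA (h : (cmAlg T E).IsCA) : (tmAlg T E).IsCA := by
  obtain ⟨⟨b1, b2, b3, b4, b5, b6, b7, b8⟩, h1, h2, h3, h4, h5, h6, h7⟩ := h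
  exact ⟨⟨fun x y => Subtype.ext (b1 x.1 y.1), fun x y => Subtype.ext (b2 x.1 y.1),
    fun x y z => Subtype.ext (b3 x.1 y.1 z.1), fun x y z => Subtype.ext (b4 x.1 y.1 z.1),
    fun x => Subtype.ext (b5 x.1), fun x => Subtype.ext (b6 x.1), fun x => Subtype.ext (b7 x.1),
    fun x => Subtype.ext (b8 x.1)⟩, fun i => Subtype.ext (h1 i), fun i x => Subtype.ext (h2 i x.1),
    fun i x y => Subtype.ext (h3 i x.1 y.1), fun i j x => Subtype.ext (h4 i j x.1),
    fun i => Subtype.ext (h5 i), fun i j k hj hk => Subtype.ext (h6 i j k hj hk),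
    fun i j x hij => Subtype.ext (h7 i j x.1 hij)⟩

/-- The singletons, as elements of the term algebra. -/
def tmAtom (T : Fin n → B → B → Prop) (E : Fin n → Fin n → Set B) (b : B) :
    (tmAlg T E).carrier := ⟨{b}, .sing b⟩

/-- A complete representation of the term algebra extends to the complex algebra. -/
theorem cmAlg_representable_of_completelyRepresentable
    (h : (tmAlg T E).CompletelyRepresentable) : (cmAlg T E).Representable := by
  obtain ⟨U, f, hinj, ⟨-, hmul, -, hzero, hone, hc, hd⟩, hsup⟩ := h
  have hf : ∀ X : (tmAlg T E).carrier, f X = ⋃ b ∈ X.1, f (tmAtom T E b) := by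
    intro X
    rw [hsup {x | ∃ b ∈ X.1, x = tmAtom T E b} X ⟨trivial, ?_, ?_⟩]
    · ext s
      simp only [Set.mem_iUnion, Set.mem_ofPred_eq, exists_prop]
      constructor
      · rintro ⟨_, ⟨b, hb, rfl⟩, hs⟩
        exact ⟨b, hb, hs⟩
      · rintro ⟨b, hb, hs⟩
        exact ⟨_, ⟨b, hb, rfl⟩, hs⟩
    · rintro _ ⟨b, hb, rfl⟩
      exact Subtype.ext (Set.union_eq_right.2 (Set.singleton_subset_iff.2 hb))
    · intro Y _ hY
      refine Subtype.ext (Set.union_eq_right.2 fun b hb => ?_)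
      exact Set.union_eq_right.1 (congrArg Subtype.val (hY _ ⟨b, hb, rfl⟩)) rfl
  have hex : ∀ s : Fin n → U, ∃ b, s ∈ f (tmAtom T E b) := by
    intro s
    have hs : s ∈ f (tmAlg T E).one := by
      rw [hone]
      exact Set.mem_univ s
    rw [hf] at hs
    simp only [Set.mem_iUnion] at hs
    obtain ⟨b, -, hb⟩ := hs
    exact ⟨b, hb⟩
  choose τ hτ using hex
  have huniq : ∀ s b, s ∈ f (tmAtom T E b) ↔ τ s = b := by
    intro s b
    refine ⟨fun hb => ?_, fun h => h ▸ hτ s⟩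
    by_contra hne
    have hmem : s ∈ f ((tmAlg T E).mul (tmAtom T E (τ s)) (tmAtom T E b)) := by
      rw [hmul]
      exact ⟨hτ s, hb⟩
    have h0 : (tmAlg T E).mul (tmAtom T E (τ s)) (tmAtom T E b) = (tmAlg T E).zero :=
      Subtype.ext (Set.singleton_inter_eq_empty.2 hne)
    rw [h0, hzero] at hmem
    exact hmem
  have hfτ : ∀ X : (tmAlg T E).carrier, f X = τ ⁻¹' X.1 := by
    intro X
    rw [hf]
    ext s
    simp [huniq]
  have hsurj : Function.Surjective τ := by
    intro b
    by_contra hb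
    refine Set.singleton_ne_empty b (congrArg Subtype.val
      (hinj (a₁ := tmAtom T E b) (a₂ := (tmAlg T E).zero) ?_))
    rw [hzero]
    refine Set.eq_empty_of_forall_notMem fun s hs => hb ⟨s, (huniq s b).1 hs⟩
  refine ⟨Unit, fun _ => U, fun X _ => τ ⁻¹' X, fun X Y h => ?_, fun X Y => rfl, fun X Y => rfl,
    fun X => rfl, rfl, rfl, fun i X => ?_, fun i j => ?_⟩
  · exact hsurj.preimage_injective (congrFun h ())
  · refine funext fun _ => Set.ext fun s => ?_
    have hcs : ∀ x, T i x (τ s) ↔ s ∈ cylSet (Fin n) U i (τ ⁻¹' {x}) := by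
      intro x
      have := hc i (tmAtom T E x)
      rw [hfτ, hfτ] at this
      exact Iff.trans ⟨fun h => ⟨x, rfl, h⟩, fun ⟨_, h, h'⟩ => h ▸ h'⟩ (Set.ext_iff.1 this s)
    constructor
    · rintro ⟨x, hx, hxs⟩
      obtain ⟨t, rfl, ht⟩ := (hcs x).1 hxs
      exact ⟨t, hx, ht⟩
    · rintro ⟨t, ht, hts⟩
      exact ⟨τ t, ht, (hcs _).2 ⟨t, rfl, hts⟩⟩
  · exact funext fun _ => ((hfτ ⟨E i j, .diag i j⟩).symm.trans (hd i j))

end TermAlgebra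

/-- The complex algebra over face types is not representable. -/
theorem FaceType.cmAlg_not_representable {n : ℕ} (hn : 2 < n) :
    ¬ (cmAlg (FaceType.Adj (n := n) (ok := okFin (C := Fin n)))
      (FaceType.diag okFin)).Representable := by
  obtain ⟨m, rfl⟩ : ∃ m, n = m + 1 := ⟨n - 1, by omega⟩
  refine FaceType.not_representable (by omega) (fun a => (a.1, a.2.2)) ?_
  rintro ⟨c, k, β⟩ ⟨d, l, γ⟩ h heq
  simp only [okFin, okLim, embLim] at h
  simp only [Prod.mk.injEq] at heq
  grind

/-- Let `2 < n < ω`.  There exist two atomic cylindric algebras of dimension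
`n` with the same atom structure, exactly one of which is representable:
there is a countable `CA_n` atom structure `S` such that the term algebra
`Tm S` is a representable `CA_n` while the complex algebra `Cm S` is not
representable.  Consequently `RCA_n` is not atom-canonical and not closed
under completions, there is a non-representable `CA_n` with a dense
representable subalgebra, and there is a countable atomic representable
`CA_n` with no complete representation. -/
theorem weakly_not_strongly_representable (n : ℕ) (hn : 2 < n) :
    (∃ (B : Type) (T : Fin n → B → B → Prop) (E : Fin n → Fin n → Set B),
      Countable B ∧ (cmAlg T E).IsCA ∧
      (tmAlg T E).Atomic ∧ (cmAlg T E).Atomic ∧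
      (tmAlg T E).Representable ∧ ¬ (cmAlg T E).Representable) ∧
    (∃ (M N : RawCA.{0, 0} (Fin n)) (f : N.carrier → M.carrier),
      M.IsCA ∧ ¬ M.Representable ∧
      (∀ X : Set M.carrier, ∃ b, M.IsLub X b) ∧
      N.Representable ∧ Function.Injective f ∧ RawCA.IsHom N M f ∧
      (∀ y : M.carrier, y ≠ M.zero → ∃ x, x ≠ N.zero ∧ M.le (f x) y)) ∧
    (∃ M : RawCA.{0, 0} (Fin n), Countable M.carrier ∧ M.IsCA ∧ M.Atomic ∧
      M.Representable ∧ ¬ M.CompletelyRepresentable) := by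
  have : Nonempty (Fin n) := ⟨⟨0, by omega⟩⟩
  have hCA : (cmAlg (FaceType.Adj (n := n) (ok := okFin (C := Fin n)))
    (FaceType.diag okFin)).IsCA := FaceType.isCA hn okFin_exists
  have hCm := FaceType.cmAlg_not_representable hn
  have hTm := FaceType.tmAlg_representable hn
  refine ⟨⟨_, _, _, inferInstance, hCA, tmAlg_atomic, cmAlg_atomic, hTm, hCm⟩,
    ⟨_, _, Subtype.val, hCA, hCm, fun X => ?_, hTm, Subtype.val_injective, ?_, fun y hy => ?_⟩,
    ⟨_, countable_tmAlg, tmAlg_isCA hCA, tmAlg_atomic, hTm,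
      fun h => hCm (cmAlg_representable_of_completelyRepresentable h)⟩⟩
  · refine ⟨Set.sUnion X, trivial, fun x hx => ?_, fun b _ hb => ?_⟩
    · exact Set.union_eq_right.2 (Set.subset_sUnion_of_mem hx)
    · exact Set.union_eq_right.2 (Set.sUnion_subset fun x hx => Set.union_eq_right.1 (hb x hx))
  · exact ⟨fun _ _ => rfl, fun _ _ => rfl, fun _ => rfl, rfl, rfl, fun _ _ => rfl, fun _ _ => rfl⟩
  · obtain ⟨b, hb⟩ := Set.nonempty_iff_ne_empty.2 hy
    exact ⟨⟨{b}, .sing b⟩, fun h => Set.singleton_ne_empty b (congrArg Subtype.val h),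
      Set.union_eq_right.2 (Set.singleton_subset_iff.2 hb)⟩
end

section
/- Let 2<n<ω. There exists an atomic algebra B∈Nr_n CA_ω (i.e. B=Nr_n C for some C∈CA_ω) with uncountably many atoms that has no complete representation; hence countability cannot be omitted in the characterization of completely representable CA_n's as the atomic members of S_c Nr_n CA_ω. -/
universe u v w

/-- Injective homomorphisms reflect the cylindric axioms. -/
theorem RawCA.IsCA.of_injective_hom {ι : Type v} {M : RawCA.{u, v} ι} {N : RawCA.{w, v} ι}
    (hN : N.IsCA) {f : M.carrier → N.carrier} (hf : Function.Injective f)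
    (hom : RawCA.IsHom M N f) : M.IsCA := by
  obtain ⟨hadd, hmul, hneg, hzero, hone, hc, hd⟩ := hom
  obtain ⟨⟨b1, b2, b3, b4, b5, b6, b7, b8⟩, c1, c2, c3, c4, c5, c6, c7⟩ := hN
  refine ⟨⟨?_, ?_, ?_, ?_, ?_, ?_, ?_, ?_⟩, ?_, ?_, ?_, ?_, ?_, ?_, ?_⟩ <;> intros <;> apply hf <;>
    simp only [hadd, hmul, hneg, hzero, hone, hc, hd]
  exacts [b1 _ _, b2 _ _, b3 _ _ _, b4 _ _ _, b5 _, b6 _, b7 _, b8 _, c1 _, c2 _ _, c3 _ _ _,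
    c4 _ _ _, c5 _, c6 _ _ _ ‹_› ‹_›, c7 _ _ _ ‹_›]

theorem mem_cylSet_iff {ι U : Type*} [DecidableEq ι] {i : ι} {X : Set (ι → U)} {s : ι → U} :
    s ∈ cylSet ι U i X ↔ ∃ a, Function.update s i a ∈ X := by
  constructor
  · rintro ⟨t, ht, h⟩
    refine ⟨t i, ?_⟩
    convert ht using 1
    ext j
    rcases eq_or_ne j i with rfl | hj
    · simp
    · simp [hj, h j hj]
  · rintro ⟨a, ha⟩
    exact ⟨_, ha, fun j hj => by simp [hj]⟩

theorem mem_diagSet_iff {ι U : Type*} {i j : ι} {s : ι → U} :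
    s ∈ diagSet ι U i j ↔ s i = s j := Iff.rfl

theorem cylSet_empty {ι U : Type*} (i : ι) : cylSet ι U i ∅ = ∅ := by
  classical
  ext s
  simp [mem_cylSet_iff]

theorem cylSet_inter_cylSet {ι U : Type*} (i : ι) (X Y : Set (ι → U)) :
    cylSet ι U i (X ∩ cylSet ι U i Y) = cylSet ι U i X ∩ cylSet ι U i Y := by
  classical
  ext s
  simp [mem_cylSet_iff]

theorem cylSet_comm {ι U : Type*} (i j : ι) (X : Set (ι → U)) :
    cylSet ι U i (cylSet ι U j X) = cylSet ι U j (cylSet ι U i X) := by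
  classical
  ext s
  simp only [mem_cylSet_iff]
  rcases eq_or_ne i j with rfl | hij
  · rfl
  · rw [exists_comm]
    simp only [Function.update_comm hij]

theorem diagSet_eq_cylSet {ι U : Type*} {i j k : ι} (hij : i ≠ j) (hik : i ≠ k) :
    diagSet ι U j k = cylSet ι U i (diagSet ι U j i ∩ diagSet ι U i k) := by
  classical
  ext s
  simp [mem_diagSet_iff, mem_cylSet_iff, hij.symm, hik.symm]

theorem mem_cylSet_diagSet_inter_iff {ι U : Type*} [DecidableEq ι] {i j : ι} (hij : i ≠ j)
    {X : Set (ι → U)} {s : ι → U} :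
    s ∈ cylSet ι U i (diagSet ι U i j ∩ X) ↔ Function.update s i (s j) ∈ X := by
  simp [mem_diagSet_iff, mem_cylSet_iff, hij.symm]

theorem fullSetAlg_isCA (ι : Type v) (U : Type u) : (fullSetAlg ι U).IsCA := by
  classical
  exact ⟨⟨Set.union_comm, Set.inter_comm, Set.union_inter_distrib_left,
    Set.inter_union_distrib_left, Set.union_empty, Set.inter_univ, Set.union_compl_self,
    Set.inter_compl_self⟩, cylSet_empty,
    fun _ _ => Set.union_eq_right.2 fun s hs => ⟨s, hs, fun _ _ => rfl⟩,
    cylSet_inter_cylSet, cylSet_comm, fun _ => Set.eq_univ_of_forall fun _ => rfl,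
    fun _ _ _ => diagSet_eq_cylSet,
    fun _ _ _ hij => Set.eq_empty_of_forall_notMem fun _ h =>
      (mem_cylSet_diagSet_inter_iff hij).1 h.2 ((mem_cylSet_diagSet_inter_iff hij).1 h.1)⟩

/-- Membership in `X` depends only on the coordinates in `F`. -/
def DependsOnCoords {ι U : Type*} (F : Set ι) (X : Set (ι → U)) : Prop :=
  ∀ s t : ι → U, (∀ k ∈ F, s k = t k) → s ∈ X → t ∈ X

theorem DependsOnCoords.of_cylSet_eq {ι U : Type*} {F : Set ι} {X : Set (ι → U)} {E : Finset ι}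
    (hE : DependsOnCoords (E : Set ι) X) (hX : ∀ k, k ∉ F → cylSet ι U k X = X) :
    DependsOnCoords F X := by
  classical
  have key : ∀ D : Finset ι, DependsOnCoords (F ∪ D) X → DependsOnCoords F X := by
    intro D
    induction D using Finset.induction_on with
    | empty => simp
    | insert a D _ ih =>
      refine fun h => ih fun s t hst hs => ?_
      by_cases ha : a ∈ F
      · refine h s t (fun k hk => hst k ?_) hs
        rcases hk with hk | hk
        · exact Or.inl hk
        · rcases Finset.mem_insert.1 hk with rfl | hk
          · exact Or.inl ha
          · exact Or.inr hk
      · rw [← hX a ha, mem_cylSet_iff]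
        refine ⟨s a, h s _ (fun k hk => ?_) hs⟩
        rcases eq_or_ne k a with rfl | hka
        · simp
        · rw [Function.update_of_ne hka]
          refine hst k ?_
          rcases hk with hk | hk
          · exact Or.inl hk
          · exact Or.inr ((Finset.mem_insert.1 hk).resolve_left hka)
  exact key E fun s t hst => hE s t fun k hk => hst k (Or.inr hk)

/-- The first `m` entries of two binary sequences coincide. -/
def Agree (m : ℕ) (x y : ℕ → ZMod 2) : Prop := ∀ k < m, x k = y k

namespace Agree

variable {m k : ℕ} {x y z : ℕ → ZMod 2}

theorem refl (m : ℕ) (x : ℕ → ZMod 2) : Agree m x x := fun _ _ => rfl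

theorem symm (h : Agree m x y) : Agree m y x := fun k hk => (h k hk).symm

theorem trans (h : Agree m x y) (h' : Agree m y z) : Agree m x z :=
  fun k hk => (h k hk).trans (h' k hk)

theorem mono (h : Agree m x y) (hk : k ≤ m) : Agree k x y := fun i hi => h i (hi.trans_le hk)

theorem succ_iff : Agree (m + 1) x y ↔ Agree m x y ∧ x m = y m := by
  simp only [Agree, Nat.lt_succ_iff_lt_or_eq]
  exact ⟨fun h => ⟨fun k hk => h k (.inl hk), h m (.inr rfl)⟩,
    fun h k hk => hk.elim (h.1 k) (by rintro rfl; exact h.2)⟩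

/-- Every node of the binary tree has only two successors. -/
theorem succ_of_iff (hx : Agree m x z) (hy : Agree m y z)
    (h : Agree (m + 1) x z ↔ Agree (m + 1) y z) : Agree (m + 1) x y := by
  have two : ∀ a b c : ZMod 2, (a = c ↔ b = c) → a = b := by decide
  simp only [succ_iff, hx, hy, true_and] at h ⊢
  exact ⟨hx.trans hy.symm, two _ _ _ h⟩

theorem add_iff (v : ℕ → ZMod 2) : Agree m (x + v) (y + v) ↔ Agree m x y := by
  simp [Agree]

end Agree

theorem exists_not_agree {x y : ℕ → ZMod 2} (h : x ≠ y) : ∃ m, ¬ Agree m x y := by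
  obtain ⟨k, hk⟩ := Function.ne_iff.1 h
  exact ⟨k + 1, fun h => hk (h k k.lt_succ_self)⟩

/-- The translation by `v` of the cone of sequences agreeing with `c` up to `m`. -/
noncomputable def coneTranslation (m : ℕ) (c v : ℕ → ZMod 2) (hv : Agree m v 0) :
    Equiv.Perm (ℕ → ZMod 2) := by
  classical
  have two : ∀ a : ZMod 2, a + a = 0 := by decide
  have hinv : Function.Involutive fun x : ℕ → ZMod 2 => if Agree m x c then x + v else x := by
    intro x
    by_cases h : Agree m x c
    · have h' : Agree m (x + v) c := fun k hk => by simp [hv k hk, h k hk]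
      simp only [h, h', if_true]
      ext k
      simp [add_assoc, two]
    · simp [h]
  exact hinv.toPerm

open Classical in
theorem coneTranslation_apply (m : ℕ) (c v : ℕ → ZMod 2) (hv : Agree m v 0) (x : ℕ → ZMod 2) :
    coneTranslation m c v hv x = if Agree m x c then x + v else x := rfl

theorem coneTranslation_agree (m : ℕ) (c v : ℕ → ZMod 2) (hv : Agree m v 0) (k : ℕ)
    (x y : ℕ → ZMod 2) :
    Agree k (coneTranslation m c v hv x) (coneTranslation m c v hv y) ↔ Agree k x y := by
  have shift : ∀ z : ℕ → ZMod 2, Agree m (coneTranslation m c v hv z) z := by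
    intro z
    rw [coneTranslation_apply]
    split_ifs
    · exact fun i hi => by simp [hv i hi]
    · exact .refl _ _
  rcases le_total k m with hk | hk
  · have hx := (shift x).mono hk
    have hy := (shift y).mono hk
    exact ⟨fun h => hx.symm.trans (h.trans hy), fun h => hx.trans (h.trans hy.symm)⟩
  · by_cases hxy : Agree m x y
    · have hc : Agree m x c ↔ Agree m y c := ⟨hxy.symm.trans, hxy.trans⟩
      by_cases hy : Agree m y c
      · simp only [coneTranslation_apply, hc, hy, if_true, Agree.add_iff]
      · simp only [coneTranslation_apply, hc, hy, if_false]
    · exact ⟨fun h => (hxy ((shift x).symm.trans ((h.mono hk).trans (shift y)))).elim,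
        fun h => (hxy (h.mono hk)).elim⟩

/-- Finite partial automorphisms of the binary tree extend to automorphisms. -/
theorem exists_tree_automorphism {ι : Type*} (s : Finset ι) (a b : ι → ℕ → ZMod 2)
    (hab : ∀ m, ∀ i j, Agree m (a i) (a j) ↔ Agree m (b i) (b j)) :
    ∃ τ : Equiv.Perm (ℕ → ZMod 2), (∀ m x y, Agree m (τ x) (τ y) ↔ Agree m x y) ∧
      ∀ i ∈ s, τ (a i) = b i := by
  classical
  induction s using Finset.induction_on with
  | empty => exact ⟨1, by simp, by simp⟩
  | insert l s _ ih =>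
    obtain ⟨τ, hτ, hτs⟩ := ih
    by_cases hc : τ (a l) = b l
    · refine ⟨τ, hτ, fun i hi => ?_⟩
      rcases Finset.mem_insert.1 hi with rfl | hi
      exacts [hc, hτs i hi]
    have hex : ∃ m, τ (a l) m ≠ b l m := Function.ne_iff.1 hc
    set m := Nat.find hex
    have hne : τ (a l) m ≠ b l m := Nat.find_spec hex
    have hag : Agree m (τ (a l)) (b l) := fun k hk => not_not.1 (Nat.find_min hex hk)
    have hv : Agree m (b l - τ (a l)) 0 := fun k hk => by simp [hag k hk]
    refine ⟨τ.trans (coneTranslation m (b l) _ hv), fun k x y => ?_, fun i hi => ?_⟩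
    · simp only [Equiv.trans_apply, coneTranslation_agree, hτ]
    · rw [Equiv.trans_apply, coneTranslation_apply]
      rcases Finset.mem_insert.1 hi with rfl | hi
      · rw [if_pos hag]
        abel
      · rw [hτs i hi, if_neg]
        intro h
        refine hne (Agree.succ_iff.1 (Agree.succ_of_iff (hag.trans h.symm) h.symm ?_)).2
        rw [← hτs i hi, hτ, hτs i hi, hab]

section

variable {κ : Type*}

/-- The permutations of the coloured tree boundary `κ × (ℕ → ZMod 2)` that preserve the colours
in `J` and the tree structure up to level `m`. -/
def localSymmetries (J : Finset κ) (m : ℕ) : Subgroup (Equiv.Perm (κ × (ℕ → ZMod 2))) where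
  carrier := {g | (∀ i ∈ J, ∀ p, (g p).1 = i ↔ p.1 = i) ∧
    ∀ k ≤ m, ∀ p q, Agree k (g p).2 (g q).2 ↔ Agree k p.2 q.2}
  mul_mem' {g h} hg hh := by
    refine ⟨fun i hi p => ?_, fun k hk p q => ?_⟩
    · rw [Equiv.Perm.mul_apply, hg.1 i hi, hh.1 i hi]
    · rw [Equiv.Perm.mul_apply, Equiv.Perm.mul_apply, hg.2 k hk, hh.2 k hk]
  one_mem' := ⟨fun _ _ _ => Iff.rfl, fun _ _ _ _ => Iff.rfl⟩
  inv_mem' {g} hg := by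
    refine ⟨fun i hi p => ?_, fun k hk p q => ?_⟩
    · simpa using (hg.1 i hi (g⁻¹ p)).symm
    · simpa using (hg.2 k hk (g⁻¹ p) (g⁻¹ q)).symm

theorem localSymmetries_anti {J J' : Finset κ} {m m' : ℕ} (hJ : J ⊆ J') (hm : m ≤ m') :
    localSymmetries J' m' ≤ localSymmetries J m :=
  fun _ hg => ⟨fun i hi => hg.1 i (hJ hi), fun k hk => hg.2 k (hk.trans hm)⟩

/-- `X` is invariant under all permutations preserving a finite part of the structure. -/
def IsLocallyInvariant {ι : Type*} (X : Set (ι → κ × (ℕ → ZMod 2))) : Prop :=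
  ∃ (J : Finset κ) (m : ℕ), ∀ g ∈ localSymmetries J m, ∀ s ∈ X, g ∘ s ∈ X

/-- The set algebra of finitely supported, locally invariant relations. -/
def invariantAlg (ι : Type v) (κ : Type u) : RawCA.{max u v, v} ι where
  carrier := {X : Set (ι → κ × (ℕ → ZMod 2)) //
    (∃ F : Finset ι, DependsOnCoords (F : Set ι) X) ∧ IsLocallyInvariant X}
  add X Y := ⟨X.1 ∪ Y.1, by
    classical
    obtain ⟨X, ⟨F, hF⟩, J, m, hX⟩ := X
    obtain ⟨Y, ⟨F', hF'⟩, J', m', hY⟩ := Y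
    refine ⟨⟨F ∪ F', fun s t h => Or.imp (hF s t fun k hk => h k ?_) (hF' s t fun k hk => h k ?_)⟩,
      J ∪ J', max m m', fun g hg s => Or.imp (hX g ?_ s) (hY g ?_ s)⟩
    · exact Finset.mem_union_left _ hk
    · exact Finset.mem_union_right _ hk
    · exact localSymmetries_anti Finset.subset_union_left (le_max_left _ _) hg
    · exact localSymmetries_anti Finset.subset_union_right (le_max_right _ _) hg⟩
  mul X Y := ⟨X.1 ∩ Y.1, by
    classical
    obtain ⟨X, ⟨F, hF⟩, J, m, hX⟩ := X
    obtain ⟨Y, ⟨F', hF'⟩, J', m', hY⟩ := Y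
    refine ⟨⟨F ∪ F', fun s t h => And.imp (hF s t fun k hk => h k ?_)
      (hF' s t fun k hk => h k ?_)⟩,
      J ∪ J', max m m', fun g hg s => And.imp (hX g ?_ s) (hY g ?_ s)⟩
    · exact Finset.mem_union_left _ hk
    · exact Finset.mem_union_right _ hk
    · exact localSymmetries_anti Finset.subset_union_left (le_max_left _ _) hg
    · exact localSymmetries_anti Finset.subset_union_right (le_max_right _ _) hg⟩
  neg X := ⟨X.1ᶜ, by
    obtain ⟨X, ⟨F, hF⟩, J, m, hX⟩ := X
    refine ⟨⟨F, fun s t h hs ht => hs (hF t s (fun k hk => (h k hk).symm) ht)⟩,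
      J, m, fun g hg s hs h => hs ?_⟩
    convert hX g⁻¹ (inv_mem hg) _ h using 1
    ext1 k
    simp⟩
  zero := ⟨∅, ⟨∅, fun _ _ _ h => h⟩, ∅, 0, fun _ _ _ h => h⟩
  one := ⟨Set.univ, ⟨∅, fun _ _ _ h => h⟩, ∅, 0, fun _ _ _ _ => trivial⟩
  c i X := ⟨cylSet ι _ i X.1, by
    classical
    obtain ⟨X, ⟨F, hF⟩, J, m, hX⟩ := X
    refine ⟨⟨F, fun s t h hs => ?_⟩, J, m, fun g hg s hs => ?_⟩ <;>
      rw [mem_cylSet_iff] at hs ⊢ <;> obtain ⟨a, ha⟩ := hs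
    · refine ⟨a, hF _ _ (fun k hk => ?_) ha⟩
      rcases eq_or_ne k i with rfl | hki
      · simp
      · simp [hki, h k hk]
    · refine ⟨g a, ?_⟩
      rw [← Function.comp_update]
      exact hX g hg _ ha⟩
  d i j := ⟨diagSet ι _ i j, by
    classical
    refine ⟨⟨{i, j}, fun s t h hs => ?_⟩, ∅, 0, fun g _ s hs => congrArg g hs⟩
    change t i = t j
    rw [← h i (by simp), ← h j (by simp)]
    exact hs⟩

theorem invariantAlg_isCA (ι : Type v) (κ : Type u) : (invariantAlg ι κ).IsCA :=
  (fullSetAlg_isCA ι (κ × (ℕ → ZMod 2))).of_injective_hom (f := Subtype.val)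
    Subtype.val_injective ⟨fun _ _ => rfl, fun _ _ => rfl, fun _ => rfl, rfl, rfl,
      fun _ _ => rfl, fun _ _ => rfl⟩

theorem invariantAlg_le_iff {ι : Type*} {X Y : (invariantAlg ι κ).carrier} :
    (invariantAlg ι κ).le X Y ↔ X.1 ⊆ Y.1 :=
  Subtype.ext_iff.trans Set.union_eq_right

theorem invariantAlg_nonempty {ι : Type*} {X : (invariantAlg ι κ).carrier}
    (h : X ≠ (invariantAlg ι κ).zero) : X.1.Nonempty :=
  Set.nonempty_iff_ne_empty.2 fun h' => h (Subtype.ext h')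

theorem exists_separating_shift (T : Finset κ) (D : Set (ℕ → ZMod 2)) (hD : D.Finite) (m : ℕ) :
    ∃ v : κ → ℕ → ZMod 2, (∀ i, Agree m (v i) 0) ∧
      ∀ i ∈ T, ∀ j ∈ T, i ≠ j → v i - v j ∉ D := by
  classical
  induction T using Finset.induction_on with
  | empty => exact ⟨0, fun _ => .refl _ _, by simp⟩
  | insert a T ha ih =>
    obtain ⟨v, hv, hvT⟩ := ih
    have hinf : {w : ℕ → ZMod 2 | Agree m w 0}.Infinite := by
      refine Set.infinite_of_injective_forall_mem (f := fun k : ℕ => Pi.single (m + k) (1 : ZMod 2))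
        (fun k l hkl => ?_) fun k i hi => ?_
      · have := congrFun hkl (m + k)
        by_contra hne
        simp [hne] at this
      · simp [show i ≠ m + k by omega]
    have hfin : (⋃ j ∈ T, ((fun d => d + v j) '' D ∪ (fun d => v j - d) '' D)).Finite :=
      T.finite_toSet.biUnion fun j _ => (hD.image _).union (hD.image _)
    obtain ⟨w, hw, hwD⟩ := (hinf.sdiff hfin).nonempty
    simp only [Set.mem_iUnion, not_exists] at hwD
    refine ⟨Function.update v a w, fun i => ?_, fun i hi j hj hij hmem => ?_⟩
    · rcases eq_or_ne i a with rfl | hia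
      · simpa using hw
      · simpa [hia] using hv i
    · rcases Finset.mem_insert.1 hi with rfl | hiT
      · have hjT := (Finset.mem_insert.1 hj).resolve_left hij.symm
        rw [Function.update_self, Function.update_of_ne hij.symm] at hmem
        exact hwD j hjT (Or.inl ⟨_, hmem, by simp⟩)
      · rcases Finset.mem_insert.1 hj with rfl | hjT
        · rw [Function.update_self, Function.update_of_ne hij] at hmem
          exact hwD i hiT (Or.inr ⟨_, hmem, by simp⟩)
        · rw [Function.update_of_ne (ne_of_mem_of_not_mem hiT ha),
            Function.update_of_ne (ne_of_mem_of_not_mem hjT ha)] at hmem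
          exact hvT i hiT j hjT hij hmem

/-- A local symmetry can move any finite tuple so that distinct entries lie on distinct
branches. -/
theorem exists_localSymmetry_separating {ι : Type*} [Fintype ι] (s : ι → κ × (ℕ → ZMod 2))
    (J : Finset κ) (m : ℕ) :
    ∃ g ∈ localSymmetries J m, ∀ k l, s k ≠ s l → (g (s k)).2 ≠ (g (s l)).2 := by
  classical
  obtain ⟨v, hv, hvs⟩ := exists_separating_shift (Finset.univ.image fun k => (s k).1)
    (Set.range fun p : ι × ι => (s p.2).2 - (s p.1).2) (Set.finite_range _) m
  let g : Equiv.Perm (κ × (ℕ → ZMod 2)) :=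
    { toFun := fun p => (p.1, p.2 + v p.1)
      invFun := fun p => (p.1, p.2 - v p.1)
      left_inv := fun p => by simp
      right_inv := fun p => by simp }
  have hg : ∀ p, g p = (p.1, p.2 + v p.1) := fun _ => rfl
  refine ⟨g, ⟨fun i _ p => by rw [hg], fun k hk p q => ?_⟩, fun k l hkl h => ?_⟩
  · have shift : ∀ p, Agree k (g p).2 p.2 := fun p i hi => by
      simp [hg, hv p.1 i (hi.trans_le hk)]
    exact ⟨fun h => (shift p).symm.trans (h.trans (shift q)),
      fun h => (shift p).trans (h.trans (shift q).symm)⟩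
  · simp only [hg] at h
    by_cases hc : (s k).1 = (s l).1
    · rw [hc] at h
      exact hkl (Prod.ext hc (add_right_cancel h))
    · refine hvs _ (by simp) _ (by simp) hc ⟨(k, l), ?_⟩
      exact sub_eq_sub_iff_add_eq_add.2 (h.symm.trans (add_comm _ _))

theorem exists_separation_level {ι : Type*} [Fintype ι] (t : ι → ℕ → ZMod 2) :
    ∃ m, ∀ k l, t k ≠ t l → ¬ Agree m (t k) (t l) := by
  classical
  have h : ∀ p : ι × ι, ∃ m, t p.1 ≠ t p.2 → ¬ Agree m (t p.1) (t p.2) := fun p => by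
    by_cases hp : t p.1 = t p.2
    · exact ⟨0, fun h => (h hp).elim⟩
    · obtain ⟨m, hm⟩ := exists_not_agree hp
      exact ⟨m, fun _ => hm⟩
  choose M hM using h
  exact ⟨Finset.univ.sup M, fun k l hkl h =>
    hM (k, l) hkl (h.mono (Finset.le_sup (Finset.mem_univ (k, l))))⟩

theorem invariantAlg_atomic (ι : Type*) [Fintype ι] : (invariantAlg ι κ).Atomic := by
  classical
  intro X hX
  obtain ⟨s, hs⟩ := invariantAlg_nonempty hX
  obtain ⟨J, m, hJ⟩ := X.2.2
  obtain ⟨g₀, hg₀, hsep⟩ := exists_localSymmetry_separating s J m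
  set t := g₀ ∘ s
  have htX : t ∈ X.1 := hJ g₀ hg₀ s hs
  have hinj : ∀ k l, t k ≠ t l → (t k).2 ≠ (t l).2 := fun k l h =>
    hsep k l fun h' => h (congrArg g₀ h')
  obtain ⟨m', hm'⟩ := exists_separation_level fun k => (t k).2
  set J' := J ∪ Finset.univ.image fun k => (t k).1
  set G := localSymmetries J' (max m m')
  have hmemJ : ∀ k, (t k).1 ∈ J' := fun k => Finset.mem_union_right _ (by simp)
  let O : (invariantAlg ι κ).carrier := ⟨{r | ∃ g ∈ G, r = g ∘ t},
    ⟨Finset.univ, fun r r' h hr => by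
      rwa [← (funext fun k => h k (by simp) : r = r')]⟩,
    J', max m m', by
      rintro g hg _ ⟨g', hg', rfl⟩
      exact ⟨g * g', mul_mem hg hg', rfl⟩⟩
  have hOX : O.1 ⊆ X.1 := by
    rintro _ ⟨g, hg, rfl⟩
    exact hJ g (localSymmetries_anti Finset.subset_union_left (le_max_left _ _) hg) t htX
  refine ⟨O, ⟨fun h => ?_, fun Y hY => ?_⟩, invariantAlg_le_iff.2 hOX⟩
  · have : t ∈ O.1 := ⟨1, one_mem _, rfl⟩
    rw [h] at this
    exact this
  · by_cases hY0 : Y = (invariantAlg ι κ).zero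
    · exact Or.inl hY0
    right
    rw [invariantAlg_le_iff] at hY
    refine Subtype.ext (hY.antisymm ?_)
    obtain ⟨r, hr⟩ := invariantAlg_nonempty hY0
    obtain ⟨g, hg, rfl⟩ := hY hr
    rintro _ ⟨g', hg', rfl⟩
    have hagree : ∀ g ∈ G, ∀ k i j, Agree k (g (t i)).2 (g (t j)).2 ↔
        Agree k (t i).2 (t j).2 := by
      intro g hg k i j
      rcases le_total k (max m m') with hk | hk
      · exact hg.2 k hk _ _
      · by_cases hij : t i = t j
        · simp only [hij]
          exact ⟨fun _ => .refl _ _, fun _ => .refl _ _⟩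
        · have hno : ¬ Agree (max m m') (t i).2 (t j).2 := fun h =>
            hm' i j (hinj i j hij) (h.mono (le_max_right _ _))
          exact ⟨fun h => (hno ((hg.2 _ le_rfl _ _).1 (h.mono hk))).elim,
            fun h => (hno (h.mono hk)).elim⟩
    obtain ⟨τ, hτ, hτt⟩ := exists_tree_automorphism Finset.univ (fun k => (g (t k)).2)
      (fun k => (g' (t k)).2) fun k i j => (hagree g hg k i j).trans (hagree g' hg' k i j).symm
    obtain ⟨J₁, m₁, h₁⟩ := Y.2.2
    have hcol : ∀ g ∈ G, ∀ k, (g (t k)).1 = (t k).1 := fun g hg k =>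
      (hg.1 _ (hmemJ k) _).2 rfl
    convert h₁ ((Equiv.refl κ).prodCongr τ) ⟨fun _ _ _ => Iff.rfl, fun k _ p q => hτ k _ _⟩ _ hr
      using 1
    ext1 k
    refine Prod.ext ?_ ?_
    · exact (hcol g' hg' k).trans (hcol g hg k).symm
    · exact (hτt k (Finset.mem_univ k)).symm

/-- The relation that the entries at `k` and `l` agree up to level `m`. -/
def agreeElt {ι : Type*} (κ : Type*) (m : ℕ) (k l : ι) : (invariantAlg ι κ).carrier :=
  ⟨{s | Agree m (s k).2 (s l).2}, by
    classical
    exact ⟨{k, l}, fun s t h hs => by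
      simpa [← h k (by simp), ← h l (by simp)] using hs⟩,
    ∅, m, fun g hg s hs => (hg.2 m le_rfl _ _).2 hs⟩

/-- The relation that the entry at `k` has colour `i`. -/
def colourElt {ι κ : Type*} (i : κ) (k : ι) : (invariantAlg ι κ).carrier :=
  ⟨{s | (s k).1 = i}, ⟨{k}, fun s t h hs => by simpa [← h k (by simp)] using hs⟩,
    {i}, 0, fun _ hg _ hs => (hg.1 i (by simp) _).2 hs⟩

theorem not_countable_atoms {ι : Type*} [Fintype ι] (k : ι) (hκ : ¬ Countable κ) :
    ¬ Countable {a : (invariantAlg ι κ).carrier // (invariantAlg ι κ).IsAtomOf a} := by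
  have hex : ∀ i : κ, ∃ a : (invariantAlg ι κ).carrier, (invariantAlg ι κ).IsAtomOf a ∧
      (invariantAlg ι κ).le a (colourElt i k) := fun i =>
    invariantAlg_atomic ι _ fun h => by
      have : (fun _ => (i, 0)) ∈ (colourElt (ι := ι) i k).1 := rfl
      rw [h] at this
      exact this
  choose a ha hle using hex
  refine fun hcount => hκ (Function.Injective.countable (f := fun i => (⟨a i, ha i⟩ :
    {a : (invariantAlg ι κ).carrier // (invariantAlg ι κ).IsAtomOf a})) fun i j hij => ?_)
  obtain ⟨s, hs⟩ := invariantAlg_nonempty (ha i).1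
  have hi : (s k).1 = i := invariantAlg_le_iff.1 (hle i) hs
  rw [show a i = a j from congrArg Subtype.val hij] at hs
  have hj : (s k).1 = j := invariantAlg_le_iff.1 (hle j) hs
  exact hi.symm.trans hj

theorem isLub_diag_or_not_agree {ι : Type*} [Fintype ι] (k l : ι) :
    (invariantAlg ι κ).IsLub
      (insert ((invariantAlg ι κ).d k l)
        (Set.range fun m => (invariantAlg ι κ).neg (agreeElt κ m k l)))
      (invariantAlg ι κ).one := by
  refine ⟨trivial, fun X _ => invariantAlg_le_iff.2 (Set.subset_univ _), fun b _ hb => ?_⟩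
  refine invariantAlg_le_iff.2 fun s _ => ?_
  by_cases hs : s k = s l
  · exact invariantAlg_le_iff.1 (hb _ (Set.mem_insert _ _)) hs
  obtain ⟨J, m, hJ⟩ := b.2.2
  obtain ⟨g, hg, hsep⟩ := exists_localSymmetry_separating s J m
  obtain ⟨m', hm'⟩ := exists_not_agree (hsep k l hs)
  have hgs : g ∘ s ∈ b.1 :=
    invariantAlg_le_iff.1 (hb _ (Set.mem_insert_of_mem _ ⟨m', rfl⟩)) hm'
  convert hJ g⁻¹ (inv_mem hg) _ hgs using 1
  ext1 j
  simp

/-- If `R 0` is total and every `R m`-ball is split by `R (m + 1)` into at most two pieces, then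
countably many codes suffice to control each `R m`. -/
theorem exists_codes {U : Type*} (R : ℕ → U → U → Prop) (h0 : ∀ x y, R 0 x y)
    (hR : ∀ m x y z, R m x z → R m y z → (R (m + 1) x z ↔ R (m + 1) y z) → R (m + 1) x y)
    (m : ℕ) : ∃ φ : U → ℕ, ∀ x y, φ x = φ y → R m x y := by
  classical
  induction m with
  | zero => exact ⟨fun _ => 0, fun x y _ => h0 x y⟩
  | succ m ih =>
    obtain ⟨φ, hφ⟩ := ih
    rcases isEmpty_or_nonempty U with hU | hU
    · exact ⟨fun _ => 0, fun x => (hU.false x).elim⟩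
    let r : ℕ → U := Function.invFun φ
    have hr : ∀ x, φ x = φ (r (φ x)) := fun x => (Function.invFun_eq ⟨x, rfl⟩).symm
    refine ⟨fun x => 2 * φ x + if R (m + 1) x (r (φ x)) then 1 else 0, fun x y hxy => ?_⟩
    have hlt : ∀ x, (if R (m + 1) x (r (φ x)) then 1 else 0) < 2 := fun x => by
      split_ifs <;> omega
    have hφxy : φ x = φ y := by
      have := hlt x
      have := hlt y
      dsimp only at hxy
      omega
    refine hR m x y (r (φ x)) (hφ _ _ (hr x)) (hφ _ _ (hφxy.symm.trans (hr x))) ?_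
    simp only [hφxy, add_right_inj] at hxy
    rw [hφxy]
    by_cases hx : R (m + 1) x (r (φ y)) <;> by_cases hy : R (m + 1) y (r (φ y)) <;>
      simp [hx, hy] at hxy ⊢

theorem invariantAlg_not_completelyRepresentable {ι : Type v} [Fintype ι] {a b c : ι}
    (hab : a ≠ b) (hac : a ≠ c) (hbc : b ≠ c) (κ : Type u)
    (hκ : ∀ φ : κ → ℕ → ℕ, ¬ Function.Injective φ) :
    ¬ (invariantAlg ι κ).CompletelyRepresentable := by
  classical
  rintro ⟨U, f, hf, ⟨hadd, hmul, hneg, hzero, hone, hc, hd⟩, hsup⟩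
  have mono : ∀ X Y : (invariantAlg ι κ).carrier, X.1 ⊆ Y.1 → f X ⊆ f Y := fun X Y h => by
    rw [← show (invariantAlg ι κ).add X Y = Y from invariantAlg_le_iff.2 h, hadd]
    exact Set.subset_union_left
  have inter : ∀ X Y s, s ∈ f X → s ∈ f Y → s ∈ f ((invariantAlg ι κ).mul X Y) :=
    fun X Y s hX hY => by
      rw [hmul]
      exact ⟨hX, hY⟩
  have compl : ∀ X s, s ∈ f ((invariantAlg ι κ).neg X) ↔ s ∉ f X := fun X s => by
    rw [hneg]
    rfl
  have dep : ∀ (F : Set ι) (X : (invariantAlg ι κ).carrier), DependsOnCoords F X.1 →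
      DependsOnCoords F (f X) := fun F X hX => by
    refine DependsOnCoords.of_cylSet_eq (E := Finset.univ)
      (fun s t h hs => by rwa [← (funext fun k => h k (by simp) : s = t)]) fun k hk => ?_
    have : (invariantAlg ι κ).c k X = X := Subtype.ext <| Set.ext fun s => by
      refine mem_cylSet_iff.trans ⟨?_, fun hs => ⟨s k, by rwa [Function.update_eq_self]⟩⟩
      rintro ⟨x, hx⟩
      refine hX _ _ (fun j hj => ?_) hx
      rw [Function.update_of_ne (ne_of_mem_of_not_mem hj hk)]
    exact (hc k X).symm.trans (congrArg f this)
  have sub : ∀ p q, p ≠ q → ∀ X s,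
      s ∈ f ((invariantAlg ι κ).c p ((invariantAlg ι κ).mul ((invariantAlg ι κ).d p q) X)) ↔
        Function.update s p (s q) ∈ f X := fun p q hpq X s => by
    rw [hc, hmul, hd]
    exact mem_cylSet_diagSet_inter_iff hpq
  let R : ℕ → U → U → Prop := fun m x y => ∃ s ∈ f (agreeElt κ m a b), s a = x ∧ s b = y
  have Rab : ∀ m s, s ∈ f (agreeElt κ m a b) ↔ R m (s a) (s b) := fun m s => by
    refine ⟨fun hs => ⟨s, hs, rfl, rfl⟩, ?_⟩
    rintro ⟨t, ht, hta, htb⟩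
    refine dep {a, b} _ (fun s t h hs => ?_) t s (by simp [hta, htb]) ht
    simpa [agreeElt, ← h a (by simp), ← h b (by simp)] using hs
  have Rac : ∀ m s, s ∈ f (agreeElt κ m a c) ↔ R m (s a) (s c) := fun m s => by
    have : agreeElt κ m a c = (invariantAlg ι κ).c b
        ((invariantAlg ι κ).mul ((invariantAlg ι κ).d b c) (agreeElt κ m a b)) :=
      Subtype.ext <| Set.ext fun s => by
        refine Iff.trans ?_ mem_cylSet_iff.symm
        simp [invariantAlg, agreeElt, diagSet, hab, hbc.symm]
    rw [this, sub b c hbc, Rab]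
    simp [hab]
  have Rbc : ∀ m s, s ∈ f (agreeElt κ m b c) ↔ R m (s b) (s c) := fun m s => by
    have : agreeElt κ m b c = (invariantAlg ι κ).c a
        ((invariantAlg ι κ).mul ((invariantAlg ι κ).d a b) (agreeElt κ m a c)) :=
      Subtype.ext <| Set.ext fun s => by
        refine Iff.trans ?_ mem_cylSet_iff.symm
        simp [invariantAlg, agreeElt, diagSet, hab.symm, hac.symm]
    rw [this, sub a b hab, Rac]
    simp [hac.symm]
  have triple : ∀ x y z : U, ∃ s : ι → U, s a = x ∧ s b = y ∧ s c = z := fun x y z =>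
    ⟨fun i => if i = a then x else if i = b then y else z, by simp [hab.symm, hac.symm, hbc.symm]⟩
  have R0 : ∀ x y, R 0 x y := fun x y => by
    obtain ⟨s, rfl, rfl, -⟩ := triple x y x
    rw [← Rab]
    refine mono (invariantAlg ι κ).one (agreeElt κ 0 a b)
      (fun t _ k hk => (Nat.not_lt_zero k hk).elim) ?_
    rw [hone]
    trivial
  have Rsucc : ∀ m x y z, R m x z → R m y z → (R (m + 1) x z ↔ R (m + 1) y z) →
      R (m + 1) x y := by
    intro m x y z hx hy h
    obtain ⟨s, rfl, rfl, rfl⟩ := triple x y z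
    rw [← Rac, ← Rbc] at h
    rw [← Rac] at hx
    rw [← Rbc] at hy
    rw [← Rab]
    by_cases h' : s ∈ f (agreeElt κ (m + 1) a c)
    · refine mono _ _ ?_ (inter _ _ s h' (h.1 h'))
      exact fun t ht => Agree.trans ht.1 (Agree.symm ht.2)
    · refine mono _ _ ?_ (inter _ _ s (inter _ _ s hx hy)
        (inter _ _ s ((compl _ s).2 h') ((compl _ s).2 (mt h.2 h'))))
      exact fun t ht => Agree.succ_of_iff ht.1.1 ht.1.2 (iff_of_false ht.2.1 ht.2.2)
  choose φ hφ using exists_codes R R0 Rsucc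
  have hcol : ∀ i : κ, (f (colourElt i a)).Nonempty := fun i => by
    refine Set.nonempty_iff_ne_empty.2 fun h => ?_
    have h' := hf (h.trans hzero.symm)
    have : (fun _ => (i, 0)) ∈ (colourElt (ι := ι) i a).1 := rfl
    rw [h'] at this
    exact this
  choose s hs using hcol
  refine hκ (fun i m => φ m (s i a)) fun i j hij => ?_
  have hR : ∀ m, R m (s i a) (s j a) := fun m => hφ m _ _ (congrFun hij m)
  obtain ⟨t, hta, htb, -⟩ := triple (s i a) (s j a) (s j a)
  have ht : t ∈ f (invariantAlg ι κ).one := by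
    rw [hone]
    trivial
  rw [hsup _ _ (isLub_diag_or_not_agree a b)] at ht
  simp only [Set.mem_iUnion, exists_prop] at ht
  obtain ⟨X, rfl | ⟨m, rfl⟩, hX⟩ := ht
  · rw [hd] at hX
    have hst : s i a = s j a := hta.symm.trans (Eq.trans hX htb)
    have hj : s i ∈ f (colourElt j a) := by
      refine dep {a} _ (fun s t h hs => ?_) (s j) (s i) (by simp [hst]) (hs j)
      simpa [colourElt, ← h a (by simp)] using hs
    by_contra hne
    have hmem : s i ∈ f (invariantAlg ι κ).zero :=
      mono ((invariantAlg ι κ).mul (colourElt i a) (colourElt j a)) (invariantAlg ι κ).zero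
        (fun t ht => (hne (Eq.trans (Eq.symm ht.1) ht.2)).elim) (inter _ _ _ (hs i) hj)
    rw [hzero] at hmem
    exact hmem
  · refine ((compl _ _).1 hX ?_).elim
    rw [Rab, hta, htb]
    exact hR m

/-- The `n`-ary invariant relations, seen as invariant relations of infinite arity. -/
def liftElt {n : ℕ} (X : (invariantAlg (Fin n) κ).carrier) : (invariantAlg ℕ κ).carrier :=
  ⟨{s | (fun i : Fin n => s i) ∈ X.1}, by
    obtain ⟨X, -, J, m, hX⟩ := X
    refine ⟨⟨Finset.range n, fun s t h hs => ?_⟩, J, m, fun g hg s hs => hX g hg _ hs⟩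
    have : (fun i : Fin n => s i) = fun i : Fin n => t i :=
      funext fun i => h i (by simp)
    rwa [Set.mem_ofPred_eq, ← this]⟩

theorem exists_extension {U : Type*} {n : ℕ} (hn : 0 < n) (s : Fin n → U) :
    ∃ t : ℕ → U, (fun i : Fin n => t i) = s :=
  ⟨fun k => if h : k < n then s ⟨k, h⟩ else s ⟨0, hn⟩, by ext i; simp⟩

theorem liftElt_isNeatEmbedding {n : ℕ} (hn : 0 < n) :
    IsNeatEmbedding (invariantAlg (Fin n) κ) (invariantAlg ℕ κ) (fun i : Fin n => (i : ℕ))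
      liftElt := by
  classical
  refine ⟨fun X Y h => Subtype.ext <| Set.ext fun s => ?_, fun _ _ => rfl, fun _ _ => rfl,
    fun _ => rfl, rfl, rfl, fun i X => Subtype.ext <| Set.ext fun s => ?_, fun _ _ => rfl,
    fun X k hk => Subtype.ext <| Set.ext fun s => ?_⟩
  · obtain ⟨t, rfl⟩ := exists_extension hn s
    exact Set.ext_iff.1 (congrArg Subtype.val h) t
  · refine Iff.trans mem_cylSet_iff (Iff.trans ?_ mem_cylSet_iff.symm)
    refine exists_congr fun x => ?_
    change _ ↔ (fun j : Fin n => Function.update s (i : ℕ) x j) ∈ X.1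
    rw [show (fun j : Fin n => Function.update s (i : ℕ) x j) =
      Function.update (fun j : Fin n => s j) i x from
        Function.update_comp_eq_of_injective s Fin.val_injective i x]
  · have h : ∀ x, (fun j : Fin n => Function.update s k x j) = fun j : Fin n => s j :=
      fun x => funext fun j => Function.update_of_ne (fun h => hk ⟨j, h⟩) _ _
    refine Iff.trans mem_cylSet_iff ⟨?_, fun hs => ⟨s k, ?_⟩⟩
    · rintro ⟨x, hx⟩
      change (fun j : Fin n => Function.update s k x j) ∈ X.1 at hx
      rwa [h] at hx
    · rwa [Function.update_eq_self]

theorem range_liftElt {n : ℕ} (hn : 0 < n) :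
    Set.range (liftElt (κ := κ) (n := n)) =
      {X | (invariantAlg ℕ κ).IsNeat (fun i : Fin n => (i : ℕ)) X} := by
  classical
  refine Set.Subset.antisymm ?_ fun X hX => ?_
  · rintro _ ⟨X, rfl⟩ k hk
    exact (liftElt_isNeatEmbedding hn).2.2.2.2.2.2.2.2 X k hk
  · obtain ⟨E, hE⟩ := X.2.1
    have hdep : DependsOnCoords (Set.range fun i : Fin n => (i : ℕ)) X.1 :=
      hE.of_cylSet_eq fun k hk => congrArg Subtype.val (hX k hk)
    have hext : ∀ t : ℕ → κ × (ℕ → ZMod 2),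
        (∃ u ∈ X.1, (fun i : Fin n => u i) = fun i : Fin n => t i) ↔ t ∈ X.1 := by
      refine fun t => ⟨?_, fun ht => ⟨t, ht, rfl⟩⟩
      rintro ⟨u, hu, hut⟩
      refine hdep u t ?_ hu
      rintro _ ⟨i, rfl⟩
      exact congrFun hut i
    obtain ⟨J, m, hJ⟩ := X.2.2
    refine ⟨⟨{s | ∃ u ∈ X.1, (fun i : Fin n => u i) = s}, ⟨Finset.univ, fun s t h hs => ?_⟩,
      J, m, ?_⟩, Subtype.ext (Set.ext hext)⟩
    · rwa [← (funext fun k => h k (by simp) : s = t)]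
    · rintro g hg _ ⟨u, hu, rfl⟩
      exact ⟨g ∘ u, hJ g hg u hu, rfl⟩

end

/-- Let `2 < n < ω`.  There exists an atomic algebra `B ∈ Nr_n CA_ω`
(i.e. `B = Nr_n C` for some `C ∈ CA_ω`) with uncountably many atoms that
has no complete representation;  hence countability cannot be omitted in the
characterization of the completely representable `CA_n`'s as the atomic
members of `S_c Nr_n CA_ω`. -/
theorem uncountable_neat_reduct_without_complete_representation (n : ℕ) (hn : 2 < n) :
    ∃ (B : RawCA.{0, 0} (Fin n)) (C : RawCA.{0, 0} ℕ) (f : B.carrier → C.carrier),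
      B.IsCA ∧ C.IsCA ∧ IsNeatEmbedding B C (fun i : Fin n => (i : ℕ)) f ∧
      Set.range f = {b : C.carrier | C.IsNeat (fun i : Fin n => (i : ℕ)) b} ∧
      B.Atomic ∧ ¬ Countable {a : B.carrier // B.IsAtomOf a} ∧
      ¬ B.CompletelyRepresentable := by
  have hκ : ∀ φ : Set (ℕ → ℕ) → ℕ → ℕ, ¬ Function.Injective φ :=
    Function.cantor_injective
  refine ⟨invariantAlg (Fin n) (Set (ℕ → ℕ)), invariantAlg ℕ (Set (ℕ → ℕ)), liftElt,
    invariantAlg_isCA _ _, invariantAlg_isCA _ _, liftElt_isNeatEmbedding (by omega),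
    range_liftElt (by omega), invariantAlg_atomic _,
    not_countable_atoms ⟨0, by omega⟩ fun h => ?_,
    invariantAlg_not_completelyRepresentable (a := (⟨0, by omega⟩ : Fin n))
      (b := ⟨1, by omega⟩) (c := ⟨2, hn⟩) (by simp) (by simp) (by simp) _ hκ⟩
  obtain ⟨φ, hφ⟩ := h.exists_injective_nat
  exact hκ (fun x _ => φ x) fun x y hxy => hφ (congrFun hxy 0)
end
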